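/- arXiv:0712.1275 — 3 statements merged into one kernel-verified Lean document; each statement's English description precedes it below -/
import Mathlib

section
/- The event {ω ∈ Ω : the derivative ω′(t) exists for no t ∈ [0,∞) (one-sided at t = 0)} is completely uncertain, i.e. both this event and its complement have upper probability 1. -/
open Filter Topology MeasureTheory
open scoped ENNReal NNReal

namespace GTP

/-- The sample space `Ω`: all continuous functions `ω : [0,∞) → ℝ`. -/
def Omega : Type := {f : ℝ≥0 → ℝ // Continuous f}

/-- The filtration: `F t` is the smallest σ-algebra on `Ω` making all maps
`ω ↦ ω s`, `s ∈ [0,t]`, measurable. -/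
def F (t : ℝ≥0) : MeasurableSpace Omega :=
  ⨆ s : {s : ℝ≥0 // s ≤ t},
    MeasurableSpace.comap (fun ω : Omega => ω.1 s.1) inferInstance

/-- A stopping time relative to the filtration `(F t)`, with values in `[0,∞]`. -/
def IsStopping (τ : Omega → ℝ≥0∞) : Prop :=
  ∀ t : ℝ≥0, MeasurableSet[F t] {ω : Omega | τ ω ≤ (t : ℝ≥0∞)}

/-- `F_τ`-measurability of a function `h : Ω → ℝ`. -/
def MeasurableAtTime (τ : Omega → ℝ≥0∞) (h : Omega → ℝ) : Prop :=
  ∀ B : Set ℝ, MeasurableSet B → ∀ t : ℝ≥0,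
    MeasurableSet[F t] (h ⁻¹' B ∩ {ω : Omega | τ ω ≤ (t : ℝ≥0∞)})

/-- An elementary trading strategy: an increasing sequence of stopping times
`τ₁ ≤ τ₂ ≤ ⋯` tending to `∞`, together with bounded `F_{τ_n}`-measurable
portfolio functions `h_n`. -/
structure ElemStrategy where
  τ : ℕ → Omega → ℝ≥0∞
  stopping : ∀ n, IsStopping (τ n)
  mono : ∀ n ω, τ n ω ≤ τ (n + 1) ω
  tendsto_top : ∀ ω, Tendsto (fun n => τ n ω) atTop (𝓝 ⊤)
  h : ℕ → Omega → ℝ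
  h_bdd : ∀ n, ∃ C : ℝ, ∀ ω, |h n ω| ≤ C
  h_meas : ∀ n, MeasurableAtTime (τ n) (h n)

/-- The time `τ ∧ t` as an element of `[0,∞)`. -/
noncomputable def clip (τ : Omega → ℝ≥0∞) (t : ℝ≥0) (ω : Omega) : ℝ≥0 :=
  (min (τ ω) (t : ℝ≥0∞)).toNNReal

/-- The elementary capital process
`K_t(ω) := c + Σ_n h_n(ω) (ω(τ_{n+1} ∧ t) − ω(τ_n ∧ t))`. -/
noncomputable def elemCapital (G : ElemStrategy) (c : ℝ) (t : ℝ≥0) (ω : Omega) : ℝ :=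
  c + ∑' n : ℕ, G.h n ω * (ω.1 (clip (G.τ (n + 1)) t ω) - ω.1 (clip (G.τ n) t ω))

/-- A positive capital process: a countable sum of nonnegative elementary capital
processes with strictly positive summable initial capitals. -/
structure PosCapital where
  G : ℕ → ElemStrategy
  c : ℕ → ℝ
  c_pos : ∀ n, 0 < c n
  c_summable : Summable c
  nonneg : ∀ n t ω, 0 ≤ elemCapital (G n) (c n) t ω

/-- The value `S_t(ω) ∈ [0,∞]` of a positive capital process. -/
noncomputable def PosCapital.value (S : PosCapital) (t : ℝ≥0) (ω : Omega) : ℝ≥0∞ :=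
  ∑' n : ℕ, ENNReal.ofReal (elemCapital (S.G n) (S.c n) t ω)

/-- The initial value `S_0` of a positive capital process (independent of `ω`,
since `K^{G_n,c_n}_0 = c_n`). -/
noncomputable def PosCapital.init (S : PosCapital) : ℝ≥0∞ :=
  ∑' n : ℕ, ENNReal.ofReal (S.c n)

/-- Upper probability:
`UpProb(E) := inf { S₀ : S a positive capital process, liminf_{t→∞} S_t ≥ 1_E }`. -/
noncomputable def UpProb (E : Set Omega) : ℝ≥0∞ :=
  ⨅ (S : PosCapital) (_ : ∀ ω : Omega,
      E.indicator (fun _ => (1 : ℝ≥0∞)) ω ≤ liminf (fun t : ℝ≥0 => S.value t ω) atTop),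
    S.init

/-- A set is null if its upper probability is `0`. -/
def IsNull (E : Set Omega) : Prop := UpProb E = 0

/-- `ω` has derivative `L` at `t ∈ [0,∞)` (one-sided at `t = 0`): the difference
quotients converge to `L` as `s → t`, `s ≠ t`, within `[0,∞)`. -/
def HasDerivAtTime (ω : Omega) (t : ℝ≥0) (L : ℝ) : Prop :=
  Tendsto (fun s : ℝ≥0 => (ω.1 s - ω.1 t) / ((s : ℝ) - (t : ℝ))) (𝓝[≠] t) (𝓝 L)

open ProbabilityTheory

/-- The closure of the set of elements with the Gaussian characteristic function. -/
lemma gauss_closed {Ω : Type*} [MeasurableSpace Ω] {P : Measure Ω} [IsProbabilityMeasure P]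
    (Y : ℕ → Lp ℝ 2 P) (Z : Lp ℝ 2 P) (hY : Tendsto Y atTop (𝓝 Z))
    (h : ∀ n (u : ℝ), ∫ ω, Complex.exp (u * (Y n ω : ℝ) * Complex.I) ∂P
      = Complex.exp (-((‖Y n‖ : ℂ) ^ 2) * u ^ 2 / 2)) (u : ℝ) :
    ∫ ω, Complex.exp (u * (Z ω : ℝ) * Complex.I) ∂P
      = Complex.exp (-((‖Z‖ : ℂ) ^ 2) * u ^ 2 / 2) := by
  have hm : TendstoInMeasure P (fun n => (Y n : Ω → ℝ)) atTop Z :=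
    tendstoInMeasure_of_tendsto_Lp hY
  obtain ⟨ns, hns, hae⟩ := hm.exists_seq_tendsto_ae
  have h1 : Tendsto (fun k => ∫ ω, Complex.exp (u * (Y (ns k) ω : ℝ) * Complex.I) ∂P) atTop
      (𝓝 (∫ ω, Complex.exp (u * (Z ω : ℝ) * Complex.I) ∂P)) := by
    apply tendsto_integral_of_dominated_convergence (fun _ => (1 : ℝ))
    · intro n
      have := (Lp.aestronglyMeasurable (Y (ns n))).aemeasurable
      apply AEMeasurable.aestronglyMeasurable
      fun_prop
    · exact integrable_const _
    · intro n
      filter_upwards with ω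
      have : (u : ℂ) * ((Y (ns n) ω : ℝ) : ℂ) = ((u * Y (ns n) ω : ℝ) : ℂ) := by push_cast; rfl
      rw [this, Complex.norm_exp_ofReal_mul_I]
    · filter_upwards [hae] with ω hω
      have hc : Continuous (fun x : ℝ => Complex.exp (u * (x : ℝ) * Complex.I)) := by fun_prop
      exact (hc.tendsto _).comp hω
  have h2 : Tendsto (fun k => Complex.exp (-((‖Y (ns k)‖ : ℂ) ^ 2) * u ^ 2 / 2)) atTop
      (𝓝 (Complex.exp (-((‖Z‖ : ℂ) ^ 2) * u ^ 2 / 2))) := by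
    have hc : Continuous (fun x : Lp ℝ 2 P => Complex.exp (-((‖x‖ : ℂ) ^ 2) * u ^ 2 / 2)) := by
      fun_prop
    exact (hc.tendsto _).comp (hY.comp hns.tendsto_atTop)
  simp_rw [h] at h1
  exact tendsto_nhds_unique h1 h2

lemma gauss_span {Ω : Type*} [MeasurableSpace Ω] {P : Measure Ω} [IsProbabilityMeasure P]
    {ι : Type*} (ξ : ι → Ω → ℝ) (hlaw : ∀ i, HasLaw (ξ i) (gaussianReal 0 1) P)
    (hind : iIndepFun ξ P) (hL : ∀ i, MemLp (ξ i) 2 P) (Z : Lp ℝ 2 P)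
    (hZ : Z ∈ Submodule.span ℝ (Set.range fun i => (hL i).toLp (ξ i))) (u : ℝ) :
    ∫ ω, Complex.exp (u * (Z ω : ℝ) * Complex.I) ∂P
      = Complex.exp (-((‖Z‖ : ℂ) ^ 2) * u ^ 2 / 2) := by
  obtain ⟨c, rfl⟩ := Finsupp.mem_span_range_iff_exists_finsupp.1 hZ
  set Z := c.sum fun i a => a • (hL i).toLp (ξ i) with hZdef
  have hae : (Z : Ω → ℝ) =ᵐ[P] fun ω => ∑ i : c.support, c i * ξ i ω := by
    have : Z = MemLp.toLp (∑ i ∈ c.support, c i • ξ i)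
        (memLp_finsetSum' _ fun i _ => (hL i).const_smul (c i)) := by
      rw [hZdef, Finsupp.sum]
      generalize c.support = s
      classical
      induction s using Finset.induction_on with
      | empty => simp
      | insert a s ha ih =>
        rw [Finset.sum_insert ha, ih]
        simp_rw [Finset.sum_insert ha]
        rfl
    rw [this]
    refine (MemLp.coeFn_toLp _).trans ?_
    filter_upwards with ω
    rw [Finset.sum_apply, ← Finset.sum_coe_sort]
    rfl
  have hG : HasGaussianLaw (fun ω => ∑ i : c.support, c i * ξ i ω) P := by
    have h1 : iIndepFun (fun i : c.support => ξ i) P :=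
      hind.precomp Subtype.val_injective
    have h2 : iIndepFun (fun (i : c.support) ω => c i * ξ i ω) P :=
      h1.comp (fun i x => c i * x) (by fun_prop)
    refine h2.hasGaussianLaw_fun_sum fun i => ?_
    exact ((hlaw i).hasGaussianLaw).fun_smul (c i)
  have hGZ : HasGaussianLaw (Z : Ω → ℝ) P := hG.congr hae.symm
  have hmean : ∫ ω, Z ω ∂P = 0 := by
    rw [integral_congr_ae hae, integral_finsetSum]
    · apply Finset.sum_eq_zero
      intro i _
      rw [integral_const_mul, (hlaw i).integral_eq, integral_id_gaussianReal, mul_zero]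
    · intro i _
      exact ((hL i).integrable (by norm_num)).const_mul _
  have hvar : Var[(Z : Ω → ℝ); P] = ‖Z‖ ^ 2 := by
    rw [variance_of_integral_eq_zero (Lp.aestronglyMeasurable Z).aemeasurable hmean,
      ← real_inner_self_eq_norm_sq, L2.inner_def]
    apply integral_congr_ae
    filter_upwards with ω
    simp [pow_two]
  have hm := hGZ.map_eq_gaussianReal
  rw [hmean, hvar] at hm
  have h3 := congrArg (fun μ => charFun μ u) hm
  simp only [charFun_gaussianReal] at h3
  rw [charFun_apply_real, integral_map (Lp.aestronglyMeasurable Z).aemeasurable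
    (by apply Continuous.aestronglyMeasurable; fun_prop)] at h3
  rw [h3]
  congr 1
  rw [Real.coe_toNNReal _ (by positivity)]
  push_cast
  ring

/-- Existence of an isonormal Gaussian process over `L²(ℝ)`. -/
lemma exists_isonormal : ∃ (Ω : Type) (_ : MeasurableSpace Ω) (P : Measure Ω)
    (_ : IsProbabilityMeasure P)
    (W : Lp ℝ 2 (volume : Measure ℝ) →ₗᵢ[ℝ] Lp ℝ 2 P),
      (∀ x, P.map (W x) = gaussianReal 0 (‖x‖₊ ^ 2)) := by
  obtain ⟨w, b, -⟩ := exists_hilbertBasis ℝ (Lp ℝ 2 (volume : Measure ℝ))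
  obtain ⟨Ω, mΩ, P, ξ, hξm, hlaw, hind, hP⟩ := exists_iid w (gaussianReal 0 1)
  have hL : ∀ i, MemLp (ξ i) 2 P := fun i => (hlaw i).hasGaussianLaw.memLp_two
  have hon : Orthonormal ℝ (fun i => (hL i).toLp (ξ i)) := by
    classical
    rw [orthonormal_iff_ite]
    intro i j
    rw [L2.inner_def]
    have : ∫ ω, inner ℝ ((hL i).toLp (ξ i) ω) ((hL j).toLp (ξ j) ω) ∂P
        = ∫ ω, ξ i ω * ξ j ω ∂P := by
      apply integral_congr_ae
      filter_upwards [(hL i).coeFn_toLp, (hL j).coeFn_toLp] with ω h1 h2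
      rw [h1, h2]; simp [mul_comm]
    rw [this]
    split_ifs with hij
    · subst hij
      have h0 : ∫ ω, ξ i ω ∂P = 0 := by
        rw [(hlaw i).integral_eq, integral_id_gaussianReal]
      have := variance_of_integral_eq_zero (hlaw i).aemeasurable h0
      rw [(hlaw i).variance_eq, variance_id_gaussianReal] at this
      simp only [← pow_two]
      rw [← this]; simp
    · have h1 := (hind.indepFun hij).integral_fun_mul_eq_mul_integral
        (hlaw i).aemeasurable.aestronglyMeasurable (hlaw j).aemeasurable.aestronglyMeasurable
      rw [h1, (hlaw i).integral_eq, integral_id_gaussianReal, zero_mul]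
  let W : Lp ℝ 2 (volume : Measure ℝ) →ₗᵢ[ℝ] Lp ℝ 2 P :=
    hon.orthogonalFamily.linearIsometry.comp b.repr.toLinearIsometry
  have hWmem : ∀ x, W x ∈ closure
      (Submodule.span ℝ (Set.range fun i => (hL i).toLp (ξ i)) : Set (Lp ℝ 2 P)) := by
    intro x
    have := hon.orthogonalFamily.hasSum_linearIsometry (b.repr x)
    refine mem_closure_of_tendsto this (Eventually.of_forall fun s => ?_)
    refine Submodule.sum_mem _ fun i _ => ?_
    simp only [LinearIsometry.toSpanSingleton_apply]
    exact Submodule.smul_mem _ _ (Submodule.subset_span ⟨i, rfl⟩)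
  have hWchar : ∀ x (u : ℝ), ∫ ω, Complex.exp (u * (W x ω : ℝ) * Complex.I) ∂P
      = Complex.exp (-((‖W x‖ : ℂ) ^ 2) * u ^ 2 / 2) := by
    intro x
    obtain ⟨Y, hY, hlim⟩ := mem_closure_iff_seq_limit.1 (hWmem x)
    exact gauss_closed Y _ hlim fun n u => gauss_span ξ hlaw hind hL _ (hY n) u
  have hWlaw : ∀ x, P.map (W x) = gaussianReal 0 (‖x‖₊ ^ 2) := by
    intro x
    have hae := (Lp.aestronglyMeasurable (W x)).aemeasurable
    have : IsProbabilityMeasure (P.map (W x)) := Measure.isProbabilityMeasure_map hae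
    apply Measure.ext_of_charFun
    ext u
    rw [charFun_gaussianReal, charFun_apply_real, integral_map hae
      (by apply Continuous.aestronglyMeasurable; fun_prop), hWchar, W.norm_map]
    congr 1
    push_cast
    simp
    ring
  exact ⟨Ω, mΩ, P, hP, W, hWlaw⟩

/-- Existence of a pre-Brownian motion. -/
lemma exists_preBrownian : ∃ (Ω : Type) (_ : MeasurableSpace Ω) (P : Measure Ω)
    (X : ℝ≥0 → Ω → ℝ), IsProbabilityMeasure P ∧ (∀ t, Measurable (X t)) ∧
      IsPreBrownianReal X P := by
  obtain ⟨Ω, mΩ, P, hP, W, hWlaw⟩ := exists_isonormal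
  have hWmean : ∀ x, ∫ ω, W x ω ∂P = 0 := by
    intro x
    have h1 : HasLaw (W x) (gaussianReal 0 (‖x‖₊ ^ 2)) P :=
      ⟨(Lp.aestronglyMeasurable (W x)).aemeasurable, hWlaw x⟩
    rw [h1.integral_eq, integral_id_gaussianReal]
  let v : ℝ≥0 → Lp ℝ 2 (volume : Measure ℝ) := fun t =>
    indicatorConstLp 2 (measurableSet_Icc (a := (0 : ℝ)) (b := t)) (by simp) 1
  let X : ℝ≥0 → Ω → ℝ := fun t =>
    (Lp.aestronglyMeasurable (W (v t))).aemeasurable.mk _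
  have hX : ∀ t, (W (v t) : Ω → ℝ) =ᵐ[P] X t := fun t => AEMeasurable.ae_eq_mk _
  refine ⟨Ω, mΩ, P, X, hP, fun t => AEMeasurable.measurable_mk _, ?_⟩
  apply IsGaussianProcess.isPreBrownianReal_of_covariance
  · refine ⟨fun I => ⟨?_⟩⟩
    have hmeas : Measurable (fun ω => I.restrict (X · ω)) :=
      measurable_pi_lambda _ fun t => AEMeasurable.measurable_mk _
    apply isGaussian_of_map_eq_gaussianReal
    intro L
    refine ⟨0, ‖∑ i : I, (L (Pi.single i 1)) • v i‖₊ ^ 2, ?_⟩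
    rw [Measure.map_map (by fun_prop) hmeas, ← hWlaw]
    apply Measure.map_congr
    have h1 : ∀ᵐ ω ∂P, ∀ i : I, W (v i) ω = X i ω := ae_all_iff.2 fun i => hX i
    have h2 : ∀ s : Finset I, (W (∑ i ∈ s, (L (Pi.single i 1)) • v i) : Ω → ℝ) =ᵐ[P]
        fun ω => ∑ i ∈ s, L (Pi.single i 1) * W (v i) ω := by
      intro s
      classical
      induction s using Finset.induction_on with
      | empty => simp only [Finset.sum_empty, map_zero]; exact Lp.coeFn_zero _ _ _
      | insert a s ha ih =>
        have e0 : W (∑ i ∈ insert a s, (L (Pi.single i 1)) • v i)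
            = (L (Pi.single a 1)) • W (v a) + W (∑ i ∈ s, (L (Pi.single i 1)) • v i) := by
          rw [Finset.sum_insert ha, map_add, map_smul]
        rw [e0]
        filter_upwards [ih, Lp.coeFn_add ((L (Pi.single a 1)) • W (v a))
          (W (∑ i ∈ s, (L (Pi.single i 1)) • v i)),
          Lp.coeFn_smul (L (Pi.single a 1)) (W (v a))] with ω g1 g2 g3
        rw [g2, Pi.add_apply, g3, g1, Finset.sum_insert ha]; rfl
    filter_upwards [h1, h2 Finset.univ] with ω g1 g2
    rw [g2]
    simp only [Function.comp]
    refine ((L : (I → ℝ) →ₗ[ℝ] ℝ).pi_apply_eq_sum_univ _).trans ?_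
    apply Finset.sum_congr rfl
    intro i _
    rw [g1 i]
    simp only [smul_eq_mul, Finset.restrict]
    rw [mul_comm]
    congr 1
    show L _ = L _
    congr 1
    ext j
    simp [Pi.single_apply, eq_comm]
  · intro t
    rw [← integral_congr_ae (hX t), hWmean]
  · intro s t hst
    have e : cov[X s, X t; P] = ∫ ω, W (v s) ω * W (v t) ω ∂P := by
      rw [covariance, ← integral_congr_ae (hX s), ← integral_congr_ae (hX t), hWmean, hWmean]
      apply integral_congr_ae
      filter_upwards [hX s, hX t] with ω g1 g2
      rw [g1, g2]; simp
    have e2 : ∫ ω, W (v s) ω * W (v t) ω ∂P = inner ℝ (W (v s)) (W (v t)) := by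
      rw [L2.inner_def]
      apply integral_congr_ae
      filter_upwards with ω
      exact mul_comm _ _
    rw [e, e2, W.inner_map_map, L2.real_inner_indicatorConstLp_one_indicatorConstLp_one measurableSet_Icc
      measurableSet_Icc (by simp) (by simp)]
    have : Set.Icc (0 : ℝ) s ∩ Set.Icc (0 : ℝ) t = Set.Icc 0 (s : ℝ) := by
      apply Set.inter_eq_left.2
      exact Set.Icc_subset_Icc_right (by exact_mod_cast hst)
    rw [this]
    simp

/-- Dyadic step approximation of a function on `[0,∞)`. -/
noncomputable def dstep (x : ℝ≥0 → ℝ) (n : ℕ) (t : ℝ≥0) : ℝ := x ((⌊2 ^ n * t⌋₊ : ℝ≥0) / 2 ^ n)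

lemma dstep_succ (x : ℝ≥0 → ℝ) (m : ℕ → ℝ) (N : ℕ)
    (h : ∀ n k : ℕ, k ≤ N * 2 ^ n →
      |x (((k + 1 : ℕ) : ℝ≥0) / 2 ^ n) - x ((k : ℝ≥0) / 2 ^ n)| ≤ m n)
    (t : ℝ≥0) (ht : t ≤ N) (n : ℕ) : |dstep x (n + 1) t - dstep x n t| ≤ m (n + 1) := by
  unfold dstep
  have hm : 0 ≤ m (n + 1) := (abs_nonneg _).trans (h (n + 1) 0 (Nat.zero_le _))
  set k := ⌊2 ^ n * t⌋₊ with hk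
  have h1 : (k : ℝ≥0) ≤ 2 ^ n * t := Nat.floor_le (by positivity)
  have h2 : 2 ^ n * t < (k : ℝ≥0) + 1 := Nat.lt_floor_add_one _
  have hkN : k ≤ N * 2 ^ n := by
    have : (k : ℝ≥0) ≤ N * 2 ^ n := h1.trans (by rw [mul_comm]; gcongr)
    exact_mod_cast this
  have e : (k : ℝ≥0) / 2 ^ n = ((2 * k : ℕ) : ℝ≥0) / 2 ^ (n + 1) := by
    rw [pow_succ]; push_cast; field_simp
  have g1 : 2 * k ≤ ⌊2 ^ (n + 1) * t⌋₊ := by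
    apply Nat.le_floor
    push_cast
    calc (2 : ℝ≥0) * k ≤ 2 * (2 ^ n * t) := by gcongr
      _ = _ := by ring
  have g2 : ⌊2 ^ (n + 1) * t⌋₊ < 2 * k + 2 := by
    rw [Nat.floor_lt (by positivity)]
    push_cast
    calc (2 : ℝ≥0) ^ (n + 1) * t = 2 * (2 ^ n * t) := by ring
      _ < 2 * ((k : ℝ≥0) + 1) := by gcongr
      _ = _ := by ring
  rw [e]
  rcases (by omega : ⌊2 ^ (n + 1) * t⌋₊ = 2 * k ∨ ⌊2 ^ (n + 1) * t⌋₊ = 2 * k + 1) with h3 | h3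
  · rw [h3]; simpa using hm
  · rw [h3]; exact h (n + 1) (2 * k) (by rw [pow_succ]; nlinarith)

lemma dstep_mod (x : ℝ≥0 → ℝ) (m : ℕ → ℝ) (N : ℕ)
    (h : ∀ n k : ℕ, k ≤ N * 2 ^ n →
      |x (((k + 1 : ℕ) : ℝ≥0) / 2 ^ n) - x ((k : ℝ≥0) / 2 ^ n)| ≤ m n)
    (s t : ℝ≥0) (hst : s ≤ t) (ht : t ≤ N) (n : ℕ) (hd : 2 ^ n * t ≤ 2 ^ n * s + 1) :
    |dstep x n t - dstep x n s| ≤ m n := by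
  unfold dstep
  have hm : 0 ≤ m n := (abs_nonneg _).trans (h n 0 (Nat.zero_le _))
  set k := ⌊2 ^ n * s⌋₊ with hk
  have h1 : (k : ℝ≥0) ≤ 2 ^ n * s := Nat.floor_le (by positivity)
  have h2 : 2 ^ n * s < (k : ℝ≥0) + 1 := Nat.lt_floor_add_one _
  have hkN : k ≤ N * 2 ^ n := by
    have : (k : ℝ≥0) ≤ N * 2 ^ n := h1.trans (by rw [mul_comm]; gcongr; exact hst.trans ht)
    exact_mod_cast this
  have g1 : k ≤ ⌊2 ^ n * t⌋₊ := Nat.floor_le_floor (by gcongr)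
  have g2 : ⌊2 ^ n * t⌋₊ < k + 2 := by
    rw [Nat.floor_lt (by positivity)]
    push_cast
    calc 2 ^ n * t ≤ 2 ^ n * s + 1 := hd
      _ < k + 1 + 1 := by gcongr
      _ = _ := by ring
  rcases (by omega : ⌊2 ^ n * t⌋₊ = k ∨ ⌊2 ^ n * t⌋₊ = k + 1) with h3 | h3
  · rw [h3]; simpa using hm
  · rw [h3]; exact h n k hkN

lemma dstep_limit (x : ℝ≥0 → ℝ) (m : ℕ → ℕ → ℝ) (hs : ∀ N, Summable (m N))
    (h : ∀ N n k : ℕ, k ≤ N * 2 ^ n →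
      |x (((k + 1 : ℕ) : ℝ≥0) / 2 ^ n) - x ((k : ℝ≥0) / 2 ^ n)| ≤ m N n) :
    ∃ B : ℝ≥0 → ℝ, (∀ t, Tendsto (fun n => dstep x n t) atTop (𝓝 (B t))) ∧ Continuous B ∧
      ∀ N : ℕ, ∀ t : ℝ≥0, t ≤ N → |B t| ≤ |x ⌊t⌋₊| + ∑' n, m N n := by
  have hm : ∀ N n, 0 ≤ m N n := fun N n => (abs_nonneg _).trans (h N n 0 (Nat.zero_le _))
  have hstep : ∀ (N : ℕ) (t : ℝ≥0), t ≤ N → ∀ n,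
      dist (dstep x n t) (dstep x (n + 1) t) ≤ m N (n + 1) := by
    intro N t ht n
    rw [dist_comm, Real.dist_eq]
    exact dstep_succ x (m N) N (h N) t ht n
  have hs' : ∀ N, Summable fun n => m N (n + 1) := fun N => (summable_nat_add_iff 1).2 (hs N)
  have hex : ∀ t : ℝ≥0, ∃ l, Tendsto (fun n => dstep x n t) atTop (𝓝 l) := by
    intro t
    obtain ⟨N, hN⟩ := exists_nat_ge t
    exact cauchySeq_tendsto_of_complete
      (cauchySeq_of_dist_le_of_summable _ (hstep N t hN) (hs' N))
  choose B hB using hex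
  have hdist : ∀ (N : ℕ) (t : ℝ≥0), t ≤ N → ∀ n,
      |dstep x n t - B t| ≤ ∑' i, m N (n + i + 1) := by
    intro N t ht n
    have := dist_le_tsum_of_dist_le_of_tendsto _ (hstep N t ht) (hs' N) (hB t) n
    rwa [Real.dist_eq] at this
  refine ⟨B, hB, ?_, ?_⟩
  · rw [continuous_iff_continuousAt]
    intro t₀
    obtain ⟨N, hN⟩ := exists_nat_ge (t₀ + 1)
    rw [Metric.continuousAt_iff]
    intro ε hε
    have htail : Tendsto (fun n => ∑' i, m N (n + i + 1)) atTop (𝓝 0) := by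
      have := tendsto_sum_nat_add (fun n => m N (n + 1))
      simpa [add_comm, add_left_comm, add_assoc] using this
    have hmz : Tendsto (m N) atTop (𝓝 0) := (hs N).tendsto_atTop_zero
    have hlim : Tendsto (fun n => m N n + 2 * ∑' i, m N (n + i + 1)) atTop (𝓝 0) := by
      simpa using hmz.add (htail.const_mul 2)
    obtain ⟨n, hn⟩ := (hlim.eventually (gt_mem_nhds hε)).exists
    have key : ∀ s t : ℝ≥0, s ≤ t → t ≤ N → 2 ^ n * t ≤ 2 ^ n * s + 1 → |B t - B s| < ε := by
      intro s t hst ht hd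
      have a1 := dstep_mod x (m N) N (h N) s t hst ht n hd
      have a2 := hdist N t ht n
      have a3 := hdist N s (hst.trans ht) n
      have : |B t - B s| ≤ m N n + 2 * ∑' i, m N (n + i + 1) := by
        rw [abs_le] at *
        constructor <;> linarith [a1.1, a1.2, a2.1, a2.2, a3.1, a3.2]
      exact this.trans_lt hn
    refine ⟨1 / 2 ^ n, by positivity, ?_⟩
    intro t ht
    have h2n : (0 : ℝ) < 2 ^ n := by positivity
    have h1n : (1 : ℝ) / 2 ^ n ≤ 1 := by
      rw [div_le_one h2n]; exact one_le_pow₀ (by norm_num)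
    rw [NNReal.dist_eq, abs_lt] at ht
    have ht1 : (2 : ℝ) ^ n * (t - t₀) ≤ 1 := by
      rw [← le_div_iff₀' h2n]; exact ht.2.le
    have ht2 : (2 : ℝ) ^ n * (t₀ - t) ≤ 1 := by
      rw [← le_div_iff₀' h2n]; linarith [ht.1]
    have hN' : (t₀ : ℝ) + 1 ≤ N := by exact_mod_cast hN
    rw [Real.dist_eq]
    rcases le_total t₀ t with hle | hle
    · apply key _ _ hle
      · rw [← NNReal.coe_le_coe]; push_cast; linarith [ht.2]
      · rw [← NNReal.coe_le_coe]; push_cast; linarith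
    · rw [abs_sub_comm]
      apply key _ _ hle
      · rw [← NNReal.coe_le_coe]; push_cast; linarith [ht.2]
      · rw [← NNReal.coe_le_coe]; push_cast; linarith
  · intro N t ht
    have a := hdist N t ht 0
    have e : dstep x 0 t = x ⌊t⌋₊ := by simp [dstep]
    have e2 : ∑' i, m N (0 + i + 1) ≤ ∑' n, m N n := by
      rw [(hs N).tsum_eq_zero_add]
      simp only [zero_add]
      linarith [hm N 0]
    rw [e] at a
    have : |B t| ≤ |x ⌊t⌋₊| + |x ⌊t⌋₊ - B t| := by
      have := abs_sub_abs_le_abs_sub (B t) (x ⌊t⌋₊)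
      rw [abs_sub_comm] at this
      linarith
    linarith

/-- Borel–Cantelli type lemma. -/
lemma summable_ae {Ω : Type*} [MeasurableSpace Ω] {P : Measure Ω} (g : ℕ → Ω → ℝ)
    (hm : ∀ n, Measurable (g n)) (h0 : ∀ n ω, 0 ≤ g n ω) (r : ℕ → ℝ) (hr : Summable r)
    (hr0 : ∀ n, 0 ≤ r n)
    (hint : ∀ n, ∫⁻ ω, ENNReal.ofReal (g n ω) ∂P ≤ ENNReal.ofReal (r n)) :
    (∀ᵐ ω ∂P, Summable fun n => g n ω) ∧ Integrable (fun ω => ∑' n, g n ω) P := by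
  have hfin : ∫⁻ ω, ∑' n, ENNReal.ofReal (g n ω) ∂P ≠ ∞ := by
    rw [lintegral_tsum (fun n => (hm n).ennreal_ofReal.aemeasurable)]
    refine ne_top_of_le_ne_top ?_ (ENNReal.tsum_le_tsum hint)
    rw [← ENNReal.ofReal_tsum_of_nonneg hr0 hr]
    exact ENNReal.ofReal_ne_top
  have hmeas : Measurable fun ω => ∑' n, ENNReal.ofReal (g n ω) :=
    Measurable.tsum fun n => (hm n).ennreal_ofReal
  constructor
  · filter_upwards [ae_lt_top hmeas hfin] with ω hω
    have := ENNReal.summable_toReal hω.ne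
    simpa [ENNReal.toReal_ofReal (h0 _ _)] using this
  · have := integrable_toReal_of_lintegral_ne_top hmeas.aemeasurable hfin
    refine this.congr (Eventually.of_forall fun ω => ?_)
    simp only
    rw [ENNReal.tsum_toReal_eq (fun n => ENNReal.ofReal_ne_top)]
    simp [ENNReal.toReal_ofReal (h0 _ _)]

lemma moment4 : ∃ C : ℝ, 0 ≤ C ∧ ∀ v : ℝ≥0,
    ∫⁻ x, ENNReal.ofReal (x ^ 4) ∂(gaussianReal 0 v) ≤ ENNReal.ofReal (C * v ^ 2) := by
  have hint : Integrable (fun x : ℝ => x ^ 4) (gaussianReal 0 1) := by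
    have := (memLp_id_gaussianReal (μ := 0) (v := 1) 4).integrable_norm_pow (by norm_num)
    refine this.congr (Eventually.of_forall fun x => ?_)
    simpa using Even.pow_abs (by decide) x
  refine ⟨∫ x, x ^ 4 ∂(gaussianReal 0 1), integral_nonneg fun x => by positivity, fun v => ?_⟩
  have e : gaussianReal 0 v = (gaussianReal 0 1).map (Real.sqrt v * ·) := by
    rw [gaussianReal_map_const_mul]
    congr 1
    · simp
    · ext; simp
  rw [e, lintegral_map (by fun_prop) (by fun_prop)]
  have : ∀ x : ℝ, ENNReal.ofReal ((Real.sqrt v * x) ^ 4)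
      = ENNReal.ofReal (v ^ 2) * ENNReal.ofReal (x ^ 4) := by
    intro x
    rw [← ENNReal.ofReal_mul (by positivity)]
    congr 1
    have : Real.sqrt v ^ 2 = v := Real.sq_sqrt (by positivity)
    calc (Real.sqrt v * x) ^ 4 = (Real.sqrt v ^ 2) ^ 2 * x ^ 4 := by ring
      _ = _ := by rw [this]
  simp_rw [this]
  rw [lintegral_const_mul _ (by fun_prop), ← ofReal_integral_eq_lintegral_ofReal hint
    (Eventually.of_forall fun x => by positivity), ← ENNReal.ofReal_mul (by positivity), mul_comm]

lemma le_add_pow4 (a y : ℝ) (ha : 0 < a) (hy : 0 ≤ y) : y ≤ a + y ^ 4 / a ^ 3 := by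
  rcases le_total y a with h | h
  · have : 0 ≤ y ^ 4 / a ^ 3 := by positivity
    linarith
  · have : y ≤ y ^ 4 / a ^ 3 := by
      rw [le_div_iff₀ (by positivity)]
      calc y * a ^ 3 ≤ y * y ^ 3 := by gcongr
        _ = y ^ 4 := by ring
    linarith

/-- Bound for the dyadic increments at level `n` on `[0,N]`. -/
noncomputable def mbd {Ω : Type*} (X : ℝ≥0 → Ω → ℝ) (N n : ℕ) (ω : Ω) : ℝ :=
  (7 / 8) ^ n + (∑ k ∈ Finset.range (N * 2 ^ n + 1),
    (X (((k + 1 : ℕ) : ℝ≥0) / 2 ^ n) ω - X ((k : ℝ≥0) / 2 ^ n) ω) ^ 4) / ((7 / 8) ^ n) ^ 3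

lemma mbd_nonneg {Ω : Type*} (X : ℝ≥0 → Ω → ℝ) (N n : ℕ) (ω : Ω) : 0 ≤ mbd X N n ω := by
  unfold mbd; positivity

lemma mbd_le {Ω : Type*} (X : ℝ≥0 → Ω → ℝ) (N n k : ℕ) (hk : k ≤ N * 2 ^ n) (ω : Ω) :
    |X (((k + 1 : ℕ) : ℝ≥0) / 2 ^ n) ω - X ((k : ℝ≥0) / 2 ^ n) ω| ≤ mbd X N n ω := by
  refine (le_add_pow4 ((7 / 8) ^ n) _ (by positivity) (abs_nonneg _)).trans ?_
  unfold mbd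
  gcongr
  rw [Even.pow_abs (by decide)]
  exact Finset.single_le_sum (f := fun k : ℕ =>
    (X (((k + 1 : ℕ) : ℝ≥0) / 2 ^ n) ω - X ((k : ℝ≥0) / 2 ^ n) ω) ^ 4)
    (fun i _ => by positivity) (Finset.mem_range.2 (by omega))

lemma inc_moment {Ω : Type*} [MeasurableSpace Ω] {P : Measure Ω} {X : ℝ≥0 → Ω → ℝ}
    (hX : IsPreBrownianReal X P) {C : ℝ} (hC : ∀ v : ℝ≥0,
      ∫⁻ x, ENNReal.ofReal (x ^ 4) ∂(gaussianReal 0 v) ≤ ENNReal.ofReal (C * v ^ 2))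
    (s t : ℝ≥0) : ∫⁻ ω, ENNReal.ofReal ((X s ω - X t ω) ^ 4) ∂P
      ≤ ENNReal.ofReal (C * (s - t : ℝ) ^ 2) := by
  have h := hX.hasLaw_sub s t
  have e := h.lintegral_comp (f := fun x : ℝ => ENNReal.ofReal (x ^ 4)) (by fun_prop)
  have e2 : ∫⁻ ω, ENNReal.ofReal ((X s ω - X t ω) ^ 4) ∂P =
    ∫⁻ x, ENNReal.ofReal (x ^ 4) ∂(gaussianReal 0 (nndist s.1 t.1)) := e
  rw [e2]
  refine (hC _).trans (le_of_eq ?_)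
  congr 2
  rw [coe_nndist, Real.dist_eq, sq_abs]
  rfl

lemma mbd_int {Ω : Type*} [MeasurableSpace Ω] {P : Measure Ω} [IsProbabilityMeasure P]
    {X : ℝ≥0 → Ω → ℝ} (hm : ∀ t, Measurable (X t))
    (hX : IsPreBrownianReal X P) {C : ℝ} (hC0 : 0 ≤ C) (hC : ∀ v : ℝ≥0,
      ∫⁻ x, ENNReal.ofReal (x ^ 4) ∂(gaussianReal 0 v) ≤ ENNReal.ofReal (C * v ^ 2))
    (N n : ℕ) : ∫⁻ ω, ENNReal.ofReal (mbd X N n ω) ∂P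
      ≤ ENNReal.ofReal ((7 / 8) ^ n + (N + 1) * C * (256 / 343) ^ n) := by
  have e : ∀ ω, ENNReal.ofReal (mbd X N n ω) = ENNReal.ofReal ((7 / 8) ^ n) +
      ENNReal.ofReal (1 / ((7 / 8) ^ n) ^ 3) * ∑ k ∈ Finset.range (N * 2 ^ n + 1), ENNReal.ofReal
        ((X (((k + 1 : ℕ) : ℝ≥0) / 2 ^ n) ω - X ((k : ℝ≥0) / 2 ^ n) ω) ^ 4) := by
    intro ω
    rw [← ENNReal.ofReal_sum_of_nonneg (fun i _ => by positivity),
      ← ENNReal.ofReal_mul (by positivity), ← ENNReal.ofReal_add (by positivity) (by positivity)]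
    congr 1
    unfold mbd
    ring
  simp_rw [e]
  rw [lintegral_add_left (by fun_prop), lintegral_const_mul _ (by fun_prop),
    lintegral_finsetSum _ (fun i _ => by fun_prop)]
  have h1 : ∀ k ∈ Finset.range (N * 2 ^ n + 1), ∫⁻ ω, ENNReal.ofReal
        ((X (((k + 1 : ℕ) : ℝ≥0) / 2 ^ n) ω - X ((k : ℝ≥0) / 2 ^ n) ω) ^ 4) ∂P
        ≤ ENNReal.ofReal (C * (1 / 2 ^ n) ^ 2) := by
    intro k _
    refine (inc_moment hX hC _ _).trans (le_of_eq ?_)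
    congr 3
    push_cast
    ring
  simp only [lintegral_const, measure_univ, mul_one]
  calc _ ≤ ENNReal.ofReal ((7 / 8) ^ n) + ENNReal.ofReal (1 / ((7 / 8) ^ n) ^ 3) *
        ∑ k ∈ Finset.range (N * 2 ^ n + 1), ENNReal.ofReal (C * (1 / 2 ^ n) ^ 2) := by
        gcongr with k hk
        exact h1 k hk
    _ = ENNReal.ofReal ((7 / 8) ^ n + (1 / ((7 / 8) ^ n) ^ 3) * ((N * 2 ^ n + 1) *
          (C * (1 / 2 ^ n) ^ 2))) := by
        rw [← ENNReal.ofReal_sum_of_nonneg (fun i _ => by positivity),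
          ← ENNReal.ofReal_mul (by positivity), ← ENNReal.ofReal_add (by positivity) (by positivity)]
        simp
    _ ≤ _ := by
        apply ENNReal.ofReal_le_ofReal
        apply add_le_add_right
        have h2 : (1 : ℝ) ≤ 2 ^ n := one_le_pow₀ (by norm_num)
        have e3 : (256 / 343 : ℝ) ^ n = 1 / ((7 / 8) ^ n) ^ 3 * (2 ^ n * (1 / 2 ^ n) ^ 2) := by
          have : (256 / 343 : ℝ) = 1 / ((7 / 8)) ^ 3 * (2 * (1 / 2) ^ 2) := by norm_num
          rw [this, mul_pow, mul_pow]
          simp only [one_div, inv_pow]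
          rw [pow_right_comm, pow_right_comm 2]
        rw [e3]
        calc 1 / ((7 / 8 : ℝ) ^ n) ^ 3 * ((N * 2 ^ n + 1) * (C * (1 / 2 ^ n) ^ 2))
            ≤ 1 / ((7 / 8 : ℝ) ^ n) ^ 3 * ((N * 2 ^ n + 2 ^ n) * (C * (1 / 2 ^ n) ^ 2)) := by gcongr
          _ = _ := by ring

lemma dstep_ae {Ω : Type*} [MeasurableSpace Ω] {P : Measure Ω} [IsProbabilityMeasure P]
    {X : ℝ≥0 → Ω → ℝ} (hm : ∀ t, Measurable (X t))
    (hX : IsPreBrownianReal X P) {C : ℝ} (hC0 : 0 ≤ C) (hC : ∀ v : ℝ≥0,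
      ∫⁻ x, ENNReal.ofReal (x ^ 4) ∂(gaussianReal 0 v) ≤ ENNReal.ofReal (C * v ^ 2))
    (t : ℝ≥0) : ∀ᵐ ω ∂P, Tendsto (fun n => dstep (X · ω) n t) atTop (𝓝 (X t ω)) := by
  have h := (summable_ae (P := P) (fun n ω => (dstep (X · ω) n t - X t ω) ^ 4)
    (fun n => by unfold dstep; fun_prop) (fun n ω => by positivity) (fun n => C * (1 / 4) ^ n)
    ((summable_geometric_of_lt_one (by norm_num) (by norm_num)).mul_left C)
    (fun n => by positivity) ?_).1
  · filter_upwards [h] with ω hω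
    have h0 := hω.tendsto_atTop_zero
    rw [← tendsto_sub_nhds_zero_iff]
    rw [Metric.tendsto_atTop] at h0 ⊢
    intro ε hε
    obtain ⟨N, hN⟩ := h0 (ε ^ 4) (by positivity)
    refine ⟨N, fun n hn => ?_⟩
    have := hN n hn
    rw [dist_zero_right, norm_pow] at this
    rw [dist_zero_right]
    exact lt_of_pow_lt_pow_left₀ 4 hε.le this
  · intro n
    refine (inc_moment hX hC _ _).trans (ENNReal.ofReal_le_ofReal ?_)
    gcongr
    have h1 : ((⌊2 ^ n * t⌋₊ : ℝ≥0) : ℝ) ≤ 2 ^ n * t := by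
      exact_mod_cast Nat.floor_le (a := 2 ^ n * t) (by positivity)
    have h2 : 2 ^ n * (t : ℝ) < ((⌊2 ^ n * t⌋₊ : ℝ≥0) : ℝ) + 1 := by
      exact_mod_cast Nat.lt_floor_add_one (2 ^ n * t)
    push_cast at h1 h2 ⊢
    set k : ℝ := (⌊2 ^ n * t⌋₊ : ℝ)
    have e4 : (1 / 4 : ℝ) ^ n = (1 / 2 ^ n) ^ 2 := by
      rw [div_pow, div_pow, ← pow_mul, mul_comm n 2, pow_mul]; norm_num
    rw [e4]
    apply sq_le_sq'
    · rw [neg_le_sub_iff_le_add, ← add_div, le_div_iff₀ (by positivity)]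
      linarith
    · rw [sub_le_iff_le_add]
      have : k / 2 ^ n ≤ t := by rw [div_le_iff₀ (by positivity)]; linarith
      have : (0 : ℝ) ≤ 1 / 2 ^ n := by positivity
      linarith

/-- Existence of Brownian motion with integrable running maximum. -/
lemma exists_brownian : ∃ (Ω : Type) (_ : MeasurableSpace Ω) (P : Measure Ω)
    (B : ℝ≥0 → Ω → ℝ), IsProbabilityMeasure P ∧ (∀ t, Measurable (B t)) ∧
      (∀ ω, Continuous fun t => B t ω) ∧ IsPreBrownianReal B P ∧
      ∀ N : ℕ, ∃ G : Ω → ℝ, Integrable G P ∧ ∀ᵐ ω ∂P, ∀ s : ℝ≥0, s ≤ N → |B s ω| ≤ G ω := by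
  obtain ⟨Ω, mΩ, P, X, hP, hm, hX⟩ := exists_preBrownian
  obtain ⟨C, hC0, hC⟩ := moment4
  have hmm : ∀ N n, Measurable (mbd X N n) := fun N n => by unfold mbd; fun_prop
  have hsum : ∀ N : ℕ, (∀ᵐ ω ∂P, Summable fun n => mbd X N n ω) ∧
      Integrable (fun ω => ∑' n, mbd X N n ω) P := by
    intro N
    refine summable_ae (fun n => mbd X N n) (hmm N) (fun n ω => mbd_nonneg _ _ _ _)
      (fun n => (7 / 8) ^ n + (N + 1) * C * (256 / 343) ^ n) ?_ (fun n => by positivity)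
      (fun n => mbd_int hm hX hC0 hC N n)
    exact (summable_geometric_of_lt_one (by norm_num) (by norm_num)).add
      ((summable_geometric_of_lt_one (by norm_num) (by norm_num)).mul_left _)
  let A : Set Ω := {ω | ∀ N : ℕ, ∑' n, ENNReal.ofReal (mbd X N n ω) ≠ ∞}
  have hA : MeasurableSet A := by
    have : A = ⋂ N : ℕ, {ω | ∑' n, ENNReal.ofReal (mbd X N n ω) = ∞}ᶜ := by
      ext ω; simp [A]
    rw [this]
    refine MeasurableSet.iInter fun N => MeasurableSet.compl ?_
    exact measurableSet_eq_fun
      (Measurable.tsum fun n => (hmm N n).ennreal_ofReal) measurable_const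
  have hAs : ∀ ω ∈ A, ∀ N, Summable fun n => mbd X N n ω := by
    intro ω hω N
    have := ENNReal.summable_toReal (hω N)
    simpa [ENNReal.toReal_ofReal (mbd_nonneg _ _ _ _)] using this
  have hAae : ∀ᵐ ω ∂P, ω ∈ A := by
    have : ∀ᵐ ω ∂P, ∀ N, Summable fun n => mbd X N n ω := ae_all_iff.2 fun N => (hsum N).1
    filter_upwards [this] with ω hω N
    rw [← ENNReal.ofReal_tsum_of_nonneg (fun n => mbd_nonneg _ _ _ _) (hω N)]
    exact ENNReal.ofReal_ne_top
  have hex : ∀ ω, ∃ b : ℝ≥0 → ℝ,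
      (∀ t, Tendsto (fun n => A.indicator (fun ω => dstep (X · ω) n t) ω) atTop (𝓝 (b t))) ∧
      Continuous b ∧ (ω ∈ A → ∀ N : ℕ, ∀ t : ℝ≥0, t ≤ N →
        |b t| ≤ |X ⌊t⌋₊ ω| + ∑' n, mbd X N n ω) := by
    intro ω
    by_cases hω : ω ∈ A
    · obtain ⟨b, h1, h2, h3⟩ := dstep_limit (X · ω) (fun N n => mbd X N n ω) (hAs ω hω)
        (fun N n k hk => mbd_le X N n k hk ω)
      refine ⟨b, ?_, h2, fun _ => h3⟩
      simpa [hω] using h1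
    · exact ⟨fun _ => 0, by simp [hω], continuous_const, fun h => absurd h hω⟩
  choose b hb1 hb2 hb3 using hex
  refine ⟨Ω, mΩ, P, fun t ω => b ω t, hP, ?_, hb2, ?_, ?_⟩
  · intro t
    refine measurable_of_tendsto_metrizable (f := fun n =>
      A.indicator (fun ω => dstep (X · ω) n t)) (fun n => ?_) ?_
    · refine Measurable.indicator ?_ hA
      unfold dstep
      fun_prop
    · rw [tendsto_pi_nhds]
      exact fun ω => hb1 ω t
  · refine hX.congr fun t => ?_
    filter_upwards [hAae, dstep_ae hm hX hC0 hC t] with ω h1 h2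
    have := hb1 ω t
    simp only [Set.indicator_of_mem h1] at this
    exact tendsto_nhds_unique h2 this
  · intro N
    refine ⟨fun ω => ∑ k ∈ Finset.range (N + 1), |X k ω| + ∑' n, mbd X N n ω, ?_, ?_⟩
    · refine Integrable.add ?_ (hsum N).2
      exact integrable_finsetSum _ fun i _ => (hX.integrable_eval _).abs
    · filter_upwards [hAae] with ω hω s hs
      refine (hb3 ω hω N s hs).trans ?_
      gcongr
      refine Finset.single_le_sum (f := fun k : ℕ => |X k ω|) (fun i _ => abs_nonneg _) ?_
      rw [Finset.mem_range, Nat.lt_succ_iff]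
      exact Nat.floor_le_of_le hs

lemma gauss_small (v : ℝ≥0) (hv : v ≠ 0) (x : ℝ) (hx : 0 ≤ x) :
    gaussianReal 0 v (Set.Icc (-x) x) ≤ ENNReal.ofReal (x / Real.sqrt v) := by
  have hv' : (0 : ℝ) < v := by positivity
  rw [gaussianReal_apply _ hv]
  have hb : ∀ y, gaussianPDF 0 v y ≤ ENNReal.ofReal ((Real.sqrt (2 * Real.pi * v))⁻¹) := by
    intro y
    rw [gaussianPDF, gaussianPDFReal_def]
    apply ENNReal.ofReal_le_ofReal
    apply mul_le_of_le_one_right (by positivity)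
    rw [Real.exp_le_one_iff]
    apply div_nonpos_of_nonpos_of_nonneg
    · have := sq_nonneg (y - 0); linarith
    · positivity
  calc ∫⁻ y in Set.Icc (-x) x, gaussianPDF 0 v y
      ≤ ∫⁻ y in Set.Icc (-x) x, ENNReal.ofReal ((Real.sqrt (2 * Real.pi * v))⁻¹) :=
        lintegral_mono hb
    _ = ENNReal.ofReal ((Real.sqrt (2 * Real.pi * v))⁻¹ * (2 * x)) := by
        rw [setLIntegral_const, Real.volume_Icc, ← ENNReal.ofReal_mul (by positivity)]
        congr 2; ring
    _ ≤ _ := by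
        apply ENNReal.ofReal_le_ofReal
        have h1 : 2 * Real.sqrt v ≤ Real.sqrt (2 * Real.pi * v) := by
          apply Real.le_sqrt_of_sq_le
          rw [mul_pow, Real.sq_sqrt hv'.le]
          nlinarith [Real.pi_gt_three]
        have h2 : 0 < Real.sqrt v := Real.sqrt_pos.2 hv'
        rw [inv_mul_eq_div, div_le_div_iff₀ (by linarith) h2]
        nlinarith

lemma deriv_inc (f : ℝ≥0 → ℝ) (t : ℝ≥0) (L : ℝ)
    (h : Tendsto (fun s : ℝ≥0 => (f s - f t) / ((s : ℝ) - (t : ℝ))) (𝓝[≠] t) (𝓝 L)) :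
    ∃ N C m₀ : ℕ, ∀ m ≥ m₀, ∃ k ≤ N * (m + 1) ^ 2, ∀ i ∈ Finset.Icc (k + 1) (k + 3),
      |f (((i + 1 : ℕ) : ℝ≥0) / ((m + 1) ^ 2 : ℕ)) - f ((i : ℝ≥0) / ((m + 1) ^ 2 : ℕ))|
        ≤ C / ((m + 1) ^ 2 : ℕ) := by
  obtain ⟨N, hN⟩ := exists_nat_ge t
  obtain ⟨c, hc⟩ := exists_nat_gt |L|
  have hev : ∀ᶠ s in 𝓝[≠] t, |(f s - f t) / ((s : ℝ) - (t : ℝ))| < c :=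
    (h.abs).eventually (gt_mem_nhds hc)
  rw [eventually_nhdsWithin_iff, Metric.eventually_nhds_iff] at hev
  obtain ⟨δ, hδ, hd⟩ := hev
  have hd' : ∀ s : ℝ≥0, |(s : ℝ) - t| < δ → |f s - f t| ≤ c * |(s : ℝ) - t| := by
    intro s hs
    by_cases hst : s = t
    · subst hst; simp
    · have h1 := hd (y := s) (by rwa [NNReal.dist_eq]) hst
      have h2 : 0 < |(s : ℝ) - t| := by
        rw [abs_pos, sub_ne_zero]; exact_mod_cast hst
      rw [abs_div, div_lt_iff₀ h2] at h1
      exact h1.le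
  obtain ⟨m₀, hm₀⟩ := exists_nat_gt (4 / δ)
  refine ⟨N, 8 * c, m₀, fun m hm => ?_⟩
  set n : ℕ := (m + 1) ^ 2 with hn
  have hn0 : 0 < n := by positivity
  have hnr : (0 : ℝ) < n := by positivity
  have hnδ : 4 / (n : ℝ) < δ := by
    rw [div_lt_comm₀ hnr hδ]
    refine hm₀.trans_le ?_
    have : m₀ ≤ n := by rw [hn]; nlinarith
    exact_mod_cast this
  have h1 : ((⌊t * n⌋₊ : ℝ≥0) : ℝ) ≤ t * n := by
    exact_mod_cast Nat.floor_le (a := t * n) (by positivity)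
  have h2 : (t * n : ℝ) < ((⌊t * n⌋₊ : ℝ≥0) : ℝ) + 1 := by
    exact_mod_cast Nat.lt_floor_add_one (t * n)
  set k : ℕ := ⌊t * n⌋₊ with hk
  push_cast at h1 h2
  refine ⟨k, ?_, ?_⟩
  · have : (k : ℝ) ≤ N * n := h1.trans (by gcongr; exact_mod_cast hN)
    exact_mod_cast this
  · have key : ∀ i : ℕ, k + 1 ≤ i → i ≤ k + 4 →
        |f ((i : ℝ≥0) / (n : ℕ)) - f t| ≤ c * (4 / n) := by
      intro i hi1 hi2
      have a1 : (k : ℝ) + 1 ≤ i := by exact_mod_cast hi1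
      have a2 : (i : ℝ) ≤ k + 4 := by exact_mod_cast hi2
      have b : |((((i : ℝ≥0) / (n : ℕ) : ℝ≥0)) : ℝ) - t| ≤ 4 / n := by
        push_cast
        rw [abs_le]
        constructor
        · rw [neg_le_sub_iff_le_add, ← add_div, le_div_iff₀ hnr]; linarith
        · rw [sub_le_iff_le_add]
          have e : (4 : ℝ) / n + t = (4 + t * n) / n := by field_simp
          rw [e, div_le_div_iff_of_pos_right hnr]; linarith
      refine (hd' _ (b.trans_lt hnδ)).trans ?_
      gcongr
    intro i hi
    rw [Finset.mem_Icc] at hi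
    have b1 := key i (by omega) (by omega)
    have b2 := key (i + 1) (by omega) (by omega)
    have e : ((8 * c : ℕ) : ℝ) / n = c * (4 / n) + c * (4 / n) := by push_cast; ring
    rw [e]
    rw [abs_le] at *
    constructor <;> linarith [b1.1, b1.2, b2.1, b2.2]

lemma inc_prob {Ω : Type*} [MeasurableSpace Ω] {P : Measure Ω} [IsProbabilityMeasure P]
    {X : ℝ≥0 → Ω → ℝ} (hX : IsPreBrownianReal X P) (m C i : ℕ) :
    P ((fun ω => X (((i + 1 : ℕ) : ℝ≥0) / ((m + 1) ^ 2 : ℕ)) ω -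
      X ((i : ℝ≥0) / ((m + 1) ^ 2 : ℕ)) ω) ⁻¹'
        Set.Icc (-(C / ((m + 1) ^ 2 : ℕ))) (C / ((m + 1) ^ 2 : ℕ))) ≤
      ENNReal.ofReal (C / (m + 1)) := by
  set n : ℕ := (m + 1) ^ 2 with hn
  have hn0 : 0 < n := by positivity
  have hnr : (0 : ℝ) < n := by positivity
  have h := hX.hasLaw_sub (((i + 1 : ℕ) : ℝ≥0) / (n : ℕ)) ((i : ℝ≥0) / (n : ℕ))
  have e := h.map_eq
  have e2 : P ((X (((i + 1 : ℕ) : ℝ≥0) / (n : ℕ)) - X ((i : ℝ≥0) / (n : ℕ))) ⁻¹'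
      Set.Icc (-(C / n : ℝ)) (C / n)) = gaussianReal 0 (nndist
        (((i + 1 : ℕ) : ℝ≥0) / (n : ℕ) : ℝ≥0).1 ((i : ℝ≥0) / (n : ℕ) : ℝ≥0).1)
          (Set.Icc (-(C / n : ℝ)) (C / n)) := by
    rw [← e, Measure.map_apply_of_aemeasurable h.aemeasurable measurableSet_Icc]
  have hv : nndist (((i + 1 : ℕ) : ℝ≥0) / (n : ℕ) : ℝ≥0).1 ((i : ℝ≥0) / (n : ℕ) : ℝ≥0).1
      = (1 / n : ℝ≥0) := by
    ext
    rw [coe_nndist, Real.dist_eq]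
    have : ((((i + 1 : ℕ) : ℝ≥0) / (n : ℕ) : ℝ≥0).1 - ((i : ℝ≥0) / (n : ℕ) : ℝ≥0).1 : ℝ)
        = 1 / n := by
      simp only [NNReal.val_eq_coe]
      push_cast
      ring
    rw [this, abs_of_nonneg (by positivity)]
    push_cast
    rfl
  refine (le_of_eq e2).trans ?_
  rw [hv]
  refine (gauss_small _ (by positivity) _ (by positivity)).trans (le_of_eq ?_)
  congr 1
  have hs : Real.sqrt ((1 / n : ℝ≥0) : ℝ) = 1 / (m + 1) := by
    rw [Real.sqrt_eq_iff_mul_self_eq (by positivity) (by positivity), hn]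
    push_cast
    field_simp
  rw [hs, hn]
  push_cast
  field_simp

lemma nowhere_diff_ae {Ω : Type*} [MeasurableSpace Ω] {P : Measure Ω} [IsProbabilityMeasure P]
    {X : ℝ≥0 → Ω → ℝ} (hX : IsPreBrownianReal X P) :
    ∀ᵐ ω ∂P, ∀ t : ℝ≥0, ∀ L : ℝ, ¬ Tendsto
      (fun s : ℝ≥0 => (X s ω - X t ω) / ((s : ℝ) - (t : ℝ))) (𝓝[≠] t) (𝓝 L) := by
  have key : ∀ N C m₀ : ℕ, ∀ᵐ ω ∂P, ¬ ∀ m ≥ m₀, ∃ k ≤ N * (m + 1) ^ 2,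
      ∀ i ∈ Finset.Icc (k + 1) (k + 3),
      |X (((i + 1 : ℕ) : ℝ≥0) / ((m + 1) ^ 2 : ℕ)) ω - X ((i : ℝ≥0) / ((m + 1) ^ 2 : ℕ)) ω|
        ≤ C / ((m + 1) ^ 2 : ℕ) := by
    intro N C m₀
    rw [ae_iff]
    simp only [not_not]
    have hb : ∀ m ≥ m₀, P {ω | ∀ m ≥ m₀, ∃ k ≤ N * (m + 1) ^ 2,
        ∀ i ∈ Finset.Icc (k + 1) (k + 3),
        |X (((i + 1 : ℕ) : ℝ≥0) / ((m + 1) ^ 2 : ℕ)) ω - X ((i : ℝ≥0) / ((m + 1) ^ 2 : ℕ)) ω|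
        ≤ C / ((m + 1) ^ 2 : ℕ)} ≤ ENNReal.ofReal ((N + 1) * C ^ 3 / ((m : ℝ) + 1)) := by
      intro m hm
      let g : ℕ → Ω → ℝ := fun i ω => X (((i + 1 : ℕ) : ℝ≥0) / ((m + 1) ^ 2 : ℕ)) ω -
        X ((i : ℝ≥0) / ((m + 1) ^ 2 : ℕ)) ω
      let I : Set ℝ := Set.Icc (-(C / ((m + 1) ^ 2 : ℕ))) (C / ((m + 1) ^ 2 : ℕ))
      have hind : iIndepFun g P := hX.hasIndepIncrements.nat
        (t := fun i : ℕ => (i : ℝ≥0) / ((m + 1) ^ 2 : ℕ)) (fun a b hab => by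
          simp only; gcongr)
      have hk : ∀ k : ℕ, P (⋂ i ∈ Finset.Icc (k + 1) (k + 3), g i ⁻¹' I) ≤
          ENNReal.ofReal ((C / (m + 1)) ^ 3) := by
        intro k
        rw [hind.measure_inter_preimage_eq_mul _ (fun i _ => measurableSet_Icc)]
        calc ∏ i ∈ Finset.Icc (k + 1) (k + 3), P (g i ⁻¹' I)
            ≤ ∏ i ∈ Finset.Icc (k + 1) (k + 3), ENNReal.ofReal (C / (m + 1)) :=
              Finset.prod_le_prod' fun i _ => inc_prob hX m C i
          _ = _ := by
            rw [Finset.prod_const, Nat.card_Icc, ← ENNReal.ofReal_pow (by positivity)]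
            congr 2
            omega
      calc _ ≤ P (⋃ k ∈ Finset.range (N * (m + 1) ^ 2 + 1),
              ⋂ i ∈ Finset.Icc (k + 1) (k + 3), g i ⁻¹' I) := by
            apply measure_mono
            intro ω hω
            obtain ⟨k, hk, hk2⟩ := hω m hm
            simp only [Set.mem_iUnion]
            refine ⟨k, Finset.mem_range.2 (by omega), ?_⟩
            simp only [Set.mem_iInter]
            intro i hi
            exact abs_le.1 (hk2 i hi)
        _ ≤ ∑ k ∈ Finset.range (N * (m + 1) ^ 2 + 1),
              P (⋂ i ∈ Finset.Icc (k + 1) (k + 3), g i ⁻¹' I) := measure_biUnion_finset_le _ _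
        _ ≤ ∑ k ∈ Finset.range (N * (m + 1) ^ 2 + 1), ENNReal.ofReal ((C / (m + 1)) ^ 3) :=
            Finset.sum_le_sum fun k _ => hk k
        _ = ENNReal.ofReal ((N * (m + 1) ^ 2 + 1) * (C / (m + 1)) ^ 3) := by
            rw [← ENNReal.ofReal_sum_of_nonneg (fun i _ => by positivity)]
            simp
        _ ≤ _ := by
            apply ENNReal.ofReal_le_ofReal
            have hm1 : (1 : ℝ) ≤ m + 1 := by
              have : (0 : ℝ) ≤ m := by positivity
              linarith
            calc (N * ((m : ℝ) + 1) ^ 2 + 1) * (C / (m + 1)) ^ 3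
                ≤ (N * ((m : ℝ) + 1) ^ 2 + (m + 1) ^ 2) * (C / (m + 1)) ^ 3 := by
                  gcongr; exact one_le_pow₀ hm1
              _ = _ := by field_simp
    refine le_antisymm (ge_of_tendsto (x := atTop) ?_ ((eventually_ge_atTop m₀).mono hb))
      zero_le
    rw [← ENNReal.ofReal_zero]
    apply ENNReal.tendsto_ofReal
    have := (tendsto_one_div_add_atTop_nhds_zero_nat (𝕜 := ℝ)).const_mul ((N + 1) * (C : ℝ) ^ 3)
    simpa [div_eq_mul_inv] using this
  have key' : ∀ᵐ ω ∂P, ∀ N C m₀ : ℕ, ¬ ∀ m ≥ m₀, ∃ k ≤ N * (m + 1) ^ 2,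
      ∀ i ∈ Finset.Icc (k + 1) (k + 3),
      |X (((i + 1 : ℕ) : ℝ≥0) / ((m + 1) ^ 2 : ℕ)) ω - X ((i : ℝ≥0) / ((m + 1) ^ 2 : ℕ)) ω|
        ≤ C / ((m + 1) ^ 2 : ℕ) :=
    ae_all_iff.2 fun N => ae_all_iff.2 fun C => ae_all_iff.2 fun m₀ => key N C m₀
  filter_upwards [key'] with ω hω t L hL
  obtain ⟨N, C, m₀, h⟩ := deriv_inc (X · ω) t L hL
  exact hω N C m₀ h

/-- The path map. -/
def pathMap {Ω : Type*} (B : ℝ≥0 → Ω → ℝ) (hc : ∀ ω, Continuous fun t => B t ω) (ω : Ω) : Omega :=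
  ⟨fun t => B t ω, hc ω⟩

/-- The `σ`-algebra generated by the process up to time `t`. -/
@[reducible] def past {Ω : Type*} (B : ℝ≥0 → Ω → ℝ) (t : ℝ≥0) : MeasurableSpace Ω :=
  MeasurableSpace.comap (fun ω (s : Set.Iic t) => B s ω) inferInstance

lemma pathMap_meas {Ω : Type*} (B : ℝ≥0 → Ω → ℝ) (hc : ∀ ω, Continuous fun t => B t ω) (t : ℝ≥0) :
    Measurable[past B t, F t] (pathMap B hc) := by
  rw [measurable_iff_comap_le]
  unfold F past
  rw [MeasurableSpace.comap_iSup]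
  refine iSup_le fun s => ?_
  rw [MeasurableSpace.comap_comp]
  have : (fun ω : Omega => ω.1 s.1) ∘ pathMap B hc =
      (fun f : Set.Iic t → ℝ => f ⟨s.1, s.2⟩) ∘ (fun ω (s : Set.Iic t) => B s ω) := rfl
  rw [this, ← MeasurableSpace.comap_comp]
  exact MeasurableSpace.comap_mono (measurable_iff_comap_le.1 (measurable_pi_apply _))

lemma past_le {Ω : Type*} [m : MeasurableSpace Ω] (B : ℝ≥0 → Ω → ℝ) (hm : ∀ t, Measurable (B t))
    (t : ℝ≥0) : past B t ≤ m :=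
  measurable_iff_comap_le.1 (measurable_pi_lambda _ fun s => hm s)

lemma inc_zero {Ω : Type*} [m : MeasurableSpace Ω] {P : Measure Ω} [IsProbabilityMeasure P]
    {B : ℝ≥0 → Ω → ℝ} (hm : ∀ t, Measurable (B t)) (hB : IsPreBrownianReal B P)
    (s t : ℝ≥0) (hst : s ≤ t) (g : Ω → ℝ) (hg : Measurable[past B s] g) :
    ∫ ω, g ω * (B t ω - B s ω) ∂P = 0 := by
  have hgm : Measurable g := hg.mono (past_le B hm s) le_rfl
  have h1 := hB.indepFun_shift s
  rw [IndepFun_iff_Indep] at h1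
  have h2 : IndepFun g (fun ω => B t ω - B s ω) P := by
    rw [IndepFun_iff_Indep]
    refine (indep_of_indep_of_le_left (indep_of_indep_of_le_right h1.symm ?_) ?_)
    · have : (fun ω => B t ω - B s ω) = (fun f : ℝ≥0 → ℝ => f (t - s)) ∘
          (fun ω u => B (s + u) ω - B s ω) := by
        funext ω
        simp only [Function.comp]
        rw [add_tsub_cancel_of_le hst]
      rw [this, ← MeasurableSpace.comap_comp]
      exact MeasurableSpace.comap_mono (measurable_iff_comap_le.1 (measurable_pi_apply _))
    · exact measurable_iff_comap_le.1 hg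
  rw [h2.integral_fun_mul_eq_mul_integral hgm.aestronglyMeasurable
    ((hm t).sub (hm s)).aestronglyMeasurable, integral_sub (hB.integrable_eval t)
      (hB.integrable_eval s), hB.integral_eval, hB.integral_eval, sub_zero, mul_zero]

open Classical in
/-- Discretised stopped increment. -/
noncomputable def disc (b : ℝ≥0 → ℝ) (u : ℝ≥0∞) (δ : ℝ≥0) (M : ℕ) : ℝ :=
  ∑ j ∈ Finset.range M, (if u ≤ ((j * δ : ℝ≥0) : ℝ≥0∞) then (1 : ℝ) else 0) *
    (b ((j + 1 : ℕ) * δ) - b (j * δ))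

lemma disc_eq (b : ℝ≥0 → ℝ) (u : ℝ≥0∞) (δ : ℝ≥0) (M : ℕ) :
    ∃ r : ℝ≥0, r ≤ M * δ ∧ (min u ((M * δ : ℝ≥0) : ℝ≥0∞)).toNNReal ≤ r ∧
      r ≤ (min u ((M * δ : ℝ≥0) : ℝ≥0∞)).toNNReal + δ ∧ disc b u δ M = b (M * δ) - b r := by
  have hle : ∀ M : ℕ, (min u ((M * δ : ℝ≥0) : ℝ≥0∞)).toNNReal ≤ M * δ := by
    intro M
    have := ENNReal.toNNReal_mono ENNReal.coe_ne_top (min_le_right u ((M * δ : ℝ≥0) : ℝ≥0∞))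
    rwa [ENNReal.toNNReal_coe] at this
  induction M with
  | zero => exact ⟨0, by simp, by simp, by simp, by simp [disc]⟩
  | succ M ih =>
    have hmono : ((M * δ : ℝ≥0) : ℝ≥0∞) ≤ (((M + 1 : ℕ) * δ : ℝ≥0) : ℝ≥0∞) := by
      rw [ENNReal.coe_le_coe]; gcongr; omega
    by_cases hu : u ≤ ((M * δ : ℝ≥0) : ℝ≥0∞)
    · obtain ⟨r, h1, h2, h3, h4⟩ := ih
      rw [min_eq_left hu] at h2 h3
      rw [min_eq_left (hu.trans hmono)]
      refine ⟨r, h1.trans (by gcongr; omega), h2, h3, ?_⟩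
      unfold disc at h4 ⊢
      rw [Finset.sum_range_succ, h4, if_pos hu]
      ring
    · push Not at hu
      refine ⟨(M + 1 : ℕ) * δ, le_rfl, hle _, ?_, ?_⟩
      · have : (M * δ : ℝ≥0) ≤ (min u (((M + 1 : ℕ) * δ : ℝ≥0) : ℝ≥0∞)).toNNReal := by
          have h := ENNReal.toNNReal_mono (ne_top_of_le_ne_top ENNReal.coe_ne_top
            (min_le_right u (((M + 1 : ℕ) * δ : ℝ≥0) : ℝ≥0∞))) (le_min hu.le hmono)
          rwa [ENNReal.toNNReal_coe] at h
        calc ((M + 1 : ℕ) : ℝ≥0) * δ = M * δ + δ := by push_cast; ring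
          _ ≤ _ := by gcongr
      · rw [sub_self]
        unfold disc
        apply Finset.sum_eq_zero
        intro j hj
        rw [if_neg, zero_mul]
        rw [not_le]
        refine lt_of_le_of_lt ?_ hu
        rw [ENNReal.coe_le_coe]
        gcongr
        rw [Finset.mem_range] at hj
        omega

lemma disc_tendsto (b : ℝ≥0 → ℝ) (hb : Continuous b) (u : ℝ≥0∞) (t : ℝ≥0) :
    Tendsto (fun N : ℕ => disc b u (t / ((N + 1 : ℕ) : ℝ≥0)) (N + 1)) atTop
      (𝓝 (b t - b ((min u (t : ℝ≥0∞)).toNNReal))) := by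
  have hN : ∀ N : ℕ, ((N + 1 : ℕ) : ℝ≥0) * (t / ((N + 1 : ℕ) : ℝ≥0)) = t := by
    intro N
    exact mul_div_cancel₀ _ (by positivity)
  choose r h1 h2 h3 h4 using fun N : ℕ => disc_eq b u (t / ((N + 1 : ℕ) : ℝ≥0)) (N + 1)
  simp only [hN] at h1 h2 h3 h4
  simp_rw [h4]
  have hz : Tendsto (fun N : ℕ => t / ((N + 1 : ℕ) : ℝ≥0)) atTop (𝓝 0) := by
    rw [← NNReal.tendsto_coe]
    have := (tendsto_const_div_atTop_nhds_zero_nat (t : ℝ)).comp (tendsto_add_atTop_nat 1)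
    simpa [Function.comp_def] using this
  have hr : Tendsto r atTop (𝓝 ((min u (t : ℝ≥0∞)).toNNReal)) := by
    refine tendsto_of_tendsto_of_tendsto_of_le_of_le tendsto_const_nhds ?_ h2 h3
    simpa using tendsto_const_nhds.add hz
  exact tendsto_const_nhds.sub ((hb.tendsto _).comp hr)

lemma ind_meas (τ σ : Omega → ℝ≥0∞) (hσ : IsStopping σ) (hle : ∀ ω, τ ω ≤ σ ω) (h : Omega → ℝ)
    (hh : MeasurableAtTime τ h) (s : ℝ≥0) :
    Measurable[F s] ({ω | σ ω ≤ (s : ℝ≥0∞)}.indicator h) := by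
  intro A hA
  have hS := hσ s
  have e : {ω | σ ω ≤ (s : ℝ≥0∞)}.indicator h ⁻¹' A =
      ((h ⁻¹' A ∩ {ω | τ ω ≤ (s : ℝ≥0∞)}) ∩ {ω | σ ω ≤ (s : ℝ≥0∞)}) ∪
      ({ω | σ ω ≤ (s : ℝ≥0∞)}ᶜ ∩ {_ω | (0 : ℝ) ∈ A}) := by
    ext ω
    by_cases hω : σ ω ≤ (s : ℝ≥0∞)
    · have := (hle ω).trans hω
      simp [Set.indicator, hω, this]
    · simp [Set.indicator, hω]
  rw [e]
  exact MeasurableSet.union (MeasurableSet.inter (hh A hA s) hS)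
    (MeasurableSet.inter hS.compl (MeasurableSet.const _))

lemma stop_zero {Ω : Type*} [m : MeasurableSpace Ω] {P : Measure Ω} [IsProbabilityMeasure P]
    {B : ℝ≥0 → Ω → ℝ} (hm : ∀ t, Measurable (B t)) (hc : ∀ ω, Continuous fun t => B t ω)
    (hB : IsPreBrownianReal B P)
    (hG : ∀ N : ℕ, ∃ G : Ω → ℝ, Integrable G P ∧ ∀ᵐ ω ∂P, ∀ s : ℝ≥0, s ≤ N → |B s ω| ≤ G ω)
    (σ : Omega → ℝ≥0∞) (h : Omega → ℝ) (C : ℝ) (hC : ∀ ω, |h ω| ≤ C)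
    (hh : ∀ s : ℝ≥0, Measurable[F s] ({ω | σ ω ≤ (s : ℝ≥0∞)}.indicator h)) (t : ℝ≥0) :
    Integrable (fun ω => h (pathMap B hc ω) *
      (B t ω - B (clip σ t (pathMap B hc ω)) ω)) P ∧
    ∫ ω, h (pathMap B hc ω) * (B t ω - B (clip σ t (pathMap B hc ω)) ω) ∂P = 0 := by
  classical
  set Φ := pathMap B hc with hΦ
  let Z : ℕ → Ω → ℝ := fun N ω => h (Φ ω) *
    disc (fun s => B s ω) (σ (Φ ω)) (t / ((N + 1 : ℕ) : ℝ≥0)) (N + 1)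
  have hZ : ∀ N ω, Z N ω = ∑ j ∈ Finset.range (N + 1),
      ({ω | σ ω ≤ ((j * (t / ((N + 1 : ℕ) : ℝ≥0)) : ℝ≥0) : ℝ≥0∞)}.indicator h (Φ ω)) *
      (B ((j + 1 : ℕ) * (t / ((N + 1 : ℕ) : ℝ≥0))) ω - B (j * (t / ((N + 1 : ℕ) : ℝ≥0))) ω) := by
    intro N ω
    simp only [Z, disc]
    rw [Finset.mul_sum]
    refine Finset.sum_congr rfl fun j _ => ?_
    rw [← mul_assoc]
    congr 1
    simp only [Set.indicator, Set.mem_ofPred_eq]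
    split_ifs <;> simp
  have hgm : ∀ s : ℝ≥0, Measurable[past B s]
      (fun ω => {ω | σ ω ≤ (s : ℝ≥0∞)}.indicator h (Φ ω)) :=
    fun s => (hh s).comp (pathMap_meas B hc s)
  have hgm' : ∀ s : ℝ≥0, Measurable
      (fun ω => {ω | σ ω ≤ (s : ℝ≥0∞)}.indicator h (Φ ω)) :=
    fun s => (hgm s).mono (past_le B hm s) le_rfl
  have hgb : ∀ (s : ℝ≥0) ω, ‖{ω | σ ω ≤ (s : ℝ≥0∞)}.indicator h (Φ ω)‖ ≤ C := by
    intro s ω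
    have h0 := hC (Φ ω)
    rw [Real.norm_eq_abs]
    simp only [Set.indicator]
    split_ifs
    · exact h0
    · simpa using (abs_nonneg _).trans h0
  have hZm : ∀ N, Measurable (Z N) := by
    intro N
    have : Z N = fun ω => _ := funext (hZ N)
    rw [this]
    refine Finset.measurable_sum _ fun j _ => ?_
    exact (hgm' _).mul ((hm _).sub (hm _))
  have hZ0 : ∀ N, ∫ ω, Z N ω ∂P = 0 := by
    intro N
    simp_rw [hZ N]
    rw [integral_finsetSum]
    · refine Finset.sum_eq_zero fun j _ => ?_
      refine inc_zero hm hB _ _ ?_ _ (hgm _)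
      gcongr; omega
    · intro j _
      exact ((hB.integrable_eval _).sub (hB.integrable_eval _)).bdd_mul
        (hgm' _).aestronglyMeasurable (Eventually.of_forall (hgb _))
  have hlim : ∀ ω, Tendsto (fun N => Z N ω) atTop
      (𝓝 (h (Φ ω) * (B t ω - B (clip σ t (Φ ω)) ω))) := by
    intro ω
    exact (disc_tendsto (fun s => B s ω) (hc ω) (σ (Φ ω)) t).const_mul _
  obtain ⟨N₀, hN₀⟩ := exists_nat_ge t
  obtain ⟨G, hGi, hGb⟩ := hG N₀
  have hbd : ∀ N, ∀ᵐ ω ∂P, ‖Z N ω‖ ≤ C * (2 * G ω) := by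
    intro N
    filter_upwards [hGb] with ω hω
    obtain ⟨r, h1, -, -, h4⟩ := disc_eq (fun s => B s ω) (σ (Φ ω)) (t / ((N + 1 : ℕ) : ℝ≥0)) (N + 1)
    have hN : ((N + 1 : ℕ) : ℝ≥0) * (t / ((N + 1 : ℕ) : ℝ≥0)) = t :=
      mul_div_cancel₀ _ (by positivity)
    rw [hN] at h1 h4
    simp only [Z]
    rw [h4, norm_mul, Real.norm_eq_abs, Real.norm_eq_abs]
    have a1 := hω t hN₀
    have a2 := hω r (h1.trans hN₀)
    have a3 : |B t ω - B r ω| ≤ 2 * G ω := by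
      rw [abs_le] at *
      constructor <;> linarith [a1.1, a1.2, a2.1, a2.2]
    exact mul_le_mul (hC _) a3 (abs_nonneg _) ((abs_nonneg _).trans (hC (Φ ω)))
  have hbi : Integrable (fun ω => C * (2 * G ω)) P := (hGi.const_mul 2).const_mul C
  constructor
  · refine hbi.mono' (aestronglyMeasurable_of_tendsto_ae atTop
      (fun N => (hZm N).aestronglyMeasurable) (Eventually.of_forall hlim)) ?_
    filter_upwards [ae_all_iff.2 hbd] with ω hω
    exact le_of_tendsto (hlim ω).norm (Eventually.of_forall hω)
  · have := tendsto_integral_of_dominated_convergence _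
      (fun N => (hZm N).aestronglyMeasurable) hbi hbd (Eventually.of_forall hlim)
    simp_rw [hZ0] at this
    exact tendsto_nhds_unique this tendsto_const_nhds

/-- Partial sums of an elementary capital process. -/
noncomputable def partCap (G : ElemStrategy) (c : ℝ) (m : ℕ) (t : ℝ≥0) (ω : Omega) : ℝ :=
  c + ∑ n ∈ Finset.range m, G.h n ω * (ω.1 (clip (G.τ (n + 1)) t ω) - ω.1 (clip (G.τ n) t ω))

lemma tau_mono (G : ElemStrategy) (ω : Omega) : Monotone fun n => G.τ n ω :=
  monotone_nat_of_le_succ fun n => G.mono n ω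

lemma clip_clip (τ σ : Omega → ℝ≥0∞) (t : ℝ≥0) (ω : Omega) :
    clip τ (clip σ t ω) ω = (min (τ ω) (min (σ ω) t)).toNNReal := by
  unfold clip
  rw [ENNReal.coe_toNNReal (ne_top_of_le_ne_top ENNReal.coe_ne_top (min_le_right _ _))]

lemma partCap_eq (G : ElemStrategy) (c : ℝ) (m : ℕ) (t : ℝ≥0) (ω : Omega) :
    partCap G c m t ω = elemCapital G c (clip (G.τ m) t ω) ω := by
  unfold partCap elemCapital
  rw [tsum_eq_sum (s := Finset.range m)]
  · congr 1
    refine Finset.sum_congr rfl fun n hn => ?_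
    rw [Finset.mem_range] at hn
    rw [clip_clip, clip_clip, ← min_assoc, ← min_assoc,
      min_eq_left (tau_mono G ω (show n + 1 ≤ m by omega)),
      min_eq_left (tau_mono G ω (show n ≤ m by omega))]
    rfl
  · intro n hn
    rw [Finset.mem_range, not_lt] at hn
    rw [clip_clip, clip_clip, ← min_assoc, ← min_assoc,
      min_eq_right (tau_mono G ω (show m ≤ n + 1 by omega)),
      min_eq_right (tau_mono G ω hn), sub_self, mul_zero]

lemma partCap_ev (G : ElemStrategy) (c : ℝ) (t : ℝ≥0) (ω : Omega) :
    ∀ᶠ m in atTop, partCap G c m t ω = elemCapital G c t ω := by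
  have : ∀ᶠ m in atTop, (t : ℝ≥0∞) < G.τ m ω :=
    (G.tendsto_top ω).eventually (lt_mem_nhds ENNReal.coe_lt_top)
  filter_upwards [this] with m hm
  rw [partCap_eq]
  congr 1
  unfold clip
  rw [min_eq_right hm.le, ENNReal.toNNReal_coe]

lemma elem_super {Ω : Type*} [m : MeasurableSpace Ω] {P : Measure Ω} [IsProbabilityMeasure P]
    {B : ℝ≥0 → Ω → ℝ} (hm : ∀ t, Measurable (B t)) (hc : ∀ ω, Continuous fun t => B t ω)
    (hB : IsPreBrownianReal B P)
    (hG : ∀ N : ℕ, ∃ G : Ω → ℝ, Integrable G P ∧ ∀ᵐ ω ∂P, ∀ s : ℝ≥0, s ≤ N → |B s ω| ≤ G ω)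
    (G : ElemStrategy) (c : ℝ) (hpos : ∀ t ω, 0 ≤ elemCapital G c t ω) (t : ℝ≥0) :
    AEMeasurable (fun ω => ENNReal.ofReal (elemCapital G c t (pathMap B hc ω))) P ∧
    ∫⁻ ω, ENNReal.ofReal (elemCapital G c t (pathMap B hc ω)) ∂P ≤ ENNReal.ofReal c := by
  set Φ := pathMap B hc with hΦ
  have hterm : ∀ n, Integrable (fun ω => G.h n (Φ ω) * ((Φ ω).1 (clip (G.τ (n + 1)) t (Φ ω)) -
      (Φ ω).1 (clip (G.τ n) t (Φ ω)))) P ∧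
      ∫ ω, G.h n (Φ ω) * ((Φ ω).1 (clip (G.τ (n + 1)) t (Φ ω)) -
      (Φ ω).1 (clip (G.τ n) t (Φ ω))) ∂P = 0 := by
    intro n
    obtain ⟨C, hC⟩ := G.h_bdd n
    have a1 := stop_zero hm hc hB hG (G.τ n) (G.h n) C hC
      (ind_meas _ _ (G.stopping n) (fun _ => le_rfl) _ (G.h_meas n)) t
    have a2 := stop_zero hm hc hB hG (G.τ (n + 1)) (G.h n) C hC
      (ind_meas _ _ (G.stopping (n + 1)) (G.mono n) _ (G.h_meas n)) t
    have e : (fun ω => G.h n (Φ ω) * ((Φ ω).1 (clip (G.τ (n + 1)) t (Φ ω)) -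
      (Φ ω).1 (clip (G.τ n) t (Φ ω)))) = fun ω =>
        G.h n (Φ ω) * (B t ω - B (clip (G.τ n) t (Φ ω)) ω) -
        G.h n (Φ ω) * (B t ω - B (clip (G.τ (n + 1)) t (Φ ω)) ω) := by
      funext ω
      have : ∀ s, (Φ ω).1 s = B s ω := fun _ => rfl
      rw [this, this]
      ring
    rw [e]
    exact ⟨a1.1.sub a2.1, by rw [integral_sub a1.1 a2.1, a1.2, a2.2, sub_zero]⟩
  have hpi : ∀ k, Integrable (fun ω => partCap G c k t (Φ ω)) P := fun k =>
    (integrable_const c).add (integrable_finsetSum _ fun n _ => (hterm n).1)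
  have hp : ∀ k, ∫⁻ ω, ENNReal.ofReal (partCap G c k t (Φ ω)) ∂P = ENNReal.ofReal c := by
    intro k
    rw [← ofReal_integral_eq_lintegral_ofReal (hpi k)
      (Eventually.of_forall fun ω => by simp only [Pi.zero_apply]; rw [partCap_eq]; exact hpos _ _)]
    congr 1
    unfold partCap
    rw [integral_add (integrable_const c) (integrable_finsetSum _ fun n _ => (hterm n).1),
      integral_finsetSum _ fun n _ => (hterm n).1]
    simp [fun n => (hterm n).2]
  have hlim : ∀ ω, Tendsto (fun k => ENNReal.ofReal (partCap G c k t (Φ ω))) atTop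
      (𝓝 (ENNReal.ofReal (elemCapital G c t (Φ ω)))) := by
    intro ω
    refine tendsto_const_nhds.congr' ?_
    filter_upwards [partCap_ev G c t (Φ ω)] with k hk
    rw [hk]
  have hmeas : ∀ k, AEMeasurable (fun ω => ENNReal.ofReal (partCap G c k t (Φ ω))) P :=
    fun k => (hpi k).aemeasurable.ennreal_ofReal
  refine ⟨aemeasurable_of_tendsto_metrizable_ae atTop hmeas (Eventually.of_forall hlim), ?_⟩
  calc ∫⁻ ω, ENNReal.ofReal (elemCapital G c t (Φ ω)) ∂P
      = ∫⁻ ω, liminf (fun k => ENNReal.ofReal (partCap G c k t (Φ ω))) atTop ∂P := by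
        congr 1; funext ω; exact (hlim ω).liminf_eq.symm
    _ ≤ liminf (fun k => ∫⁻ ω, ENNReal.ofReal (partCap G c k t (Φ ω)) ∂P) atTop :=
        lintegral_liminf_le' hmeas
    _ = ENNReal.ofReal c := by simp_rw [hp]; simp

lemma up_ge_of_ae {Ω : Type*} [m : MeasurableSpace Ω] {P : Measure Ω} [IsProbabilityMeasure P]
    {B : ℝ≥0 → Ω → ℝ} (hm : ∀ t, Measurable (B t)) (hc : ∀ ω, Continuous fun t => B t ω)
    (hB : IsPreBrownianReal B P)
    (hG : ∀ N : ℕ, ∃ G : Ω → ℝ, Integrable G P ∧ ∀ᵐ ω ∂P, ∀ s : ℝ≥0, s ≤ N → |B s ω| ≤ G ω)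
    (E : Set Omega) (hE : ∀ᵐ ω ∂P, pathMap B hc ω ∈ E) : 1 ≤ UpProb E := by
  unfold UpProb
  refine le_iInf₂ fun S hS => ?_
  set Φ := pathMap B hc with hΦ
  have hel := fun n t => elem_super hm hc hB hG (S.G n) (S.c n) (S.nonneg n) t
  have hvm : ∀ k : ℕ, AEMeasurable (fun ω => S.value k (Φ ω)) P := fun k =>
    AEMeasurable.tsum fun n => (hel n k).1
  have hv : ∀ k : ℕ, ∫⁻ ω, S.value k (Φ ω) ∂P ≤ S.init := by
    intro k
    unfold PosCapital.value PosCapital.init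
    rw [lintegral_tsum fun n => (hel n k).1]
    exact ENNReal.tsum_le_tsum fun n => (hel n k).2
  calc (1 : ℝ≥0∞) = ∫⁻ _ω, 1 ∂P := by simp
    _ ≤ ∫⁻ ω, liminf (fun k : ℕ => S.value k (Φ ω)) atTop ∂P := by
        apply lintegral_mono_ae
        filter_upwards [hE] with ω hω
        have h1 := hS (Φ ω)
        rw [Set.indicator_of_mem hω] at h1
        refine h1.trans ?_
        have := liminf_le_liminf_of_le (u := fun t : ℝ≥0 => S.value t (Φ ω))
          (tendsto_natCast_atTop_atTop (R := ℝ≥0))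
        exact this
    _ ≤ liminf (fun k : ℕ => ∫⁻ ω, S.value k (Φ ω) ∂P) atTop := lintegral_liminf_le' hvm
    _ ≤ liminf (fun _ : ℕ => S.init) atTop := liminf_le_liminf (Eventually.of_forall hv)
    _ = S.init := by simp

/-- The trivial capital process. -/
lemma up_le_one (E : Set Omega) : UpProb E ≤ 1 := by
  let G : ElemStrategy :=
    { τ := fun n _ => n
      stopping := fun n t => MeasurableSet.const _
      mono := fun n _ => by exact_mod_cast Nat.le_succ n
      tendsto_top := fun _ => ENNReal.tendsto_nat_nhds_top
      h := fun _ _ => 0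
      h_bdd := fun _ => ⟨0, fun _ => by simp⟩
      h_meas := fun n A _ t => MeasurableSet.const ((0 : ℝ) ∈ A ∧ ((n : ℝ≥0∞) ≤ t)) }
  have hG : ∀ c t ω, elemCapital G c t ω = c := by
    intro c t ω
    simp [elemCapital, G]
  have hs : HasSum (fun n : ℕ => (1 / 2 : ℝ) / 2 ^ n) 1 := by
    simpa using hasSum_geometric_two' (1 : ℝ)
  let S : PosCapital :=
    { G := fun _ => G
      c := fun n => (1 / 2 : ℝ) / 2 ^ n
      c_pos := fun n => by positivity
      c_summable := hs.summable
      nonneg := fun n t ω => by rw [hG]; positivity }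
  have hi : S.init = 1 := by
    unfold PosCapital.init
    rw [← ENNReal.ofReal_tsum_of_nonneg (fun n => (S.c_pos n).le) S.c_summable]
    have : ∑' n, S.c n = 1 := hs.tsum_eq
    rw [this, ENNReal.ofReal_one]
  have hv : ∀ t ω, S.value t ω = 1 := by
    intro t ω
    rw [← hi]
    unfold PosCapital.value PosCapital.init
    refine tsum_congr fun n => ?_
    congr 1
    exact hG _ _ _
  unfold UpProb
  refine (iInf₂_le S ?_).trans hi.le
  intro ω
  simp only [hv, liminf_const]
  exact Set.indicator_le_self' (fun _ _ => zero_le) ω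

/-- A constant path. -/
def constPath (a : ℝ) : Omega := ⟨fun _ => a, continuous_const⟩

/-- Events containing a constant path have upper probability at least `1`. -/
lemma up_ge_of_const (E : Set Omega) (a : ℝ) (h : constPath a ∈ E) :
    1 ≤ UpProb E := by
  unfold UpProb
  refine le_iInf₂ fun S hS => ?_
  have h1 := hS (constPath a)
  rw [Set.indicator_of_mem h] at h1
  have h2 : ∀ t, S.value t (constPath a) = S.init := by
    intro t
    simp [PosCapital.value, PosCapital.init, elemCapital, constPath]
  simpa [h2] using h1

/-- the event that `ω` is nowhere differentiable on `[0,∞)` is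
completely uncertain. -/
theorem nowhere_differentiable_completely_uncertain :
    UpProb {ω : Omega | ∀ t : ℝ≥0, ∀ L : ℝ, ¬ HasDerivAtTime ω t L} = 1 ∧
      UpProb {ω : Omega | ∀ t : ℝ≥0, ∀ L : ℝ, ¬ HasDerivAtTime ω t L}ᶜ = 1 := by
  refine ⟨le_antisymm (up_le_one _) ?_, le_antisymm (up_le_one _) ?_⟩
  · obtain ⟨Ω, mΩ, P, B, hP, hm, hc, hB, hG⟩ := exists_brownian
    exact up_ge_of_ae hm hc hB hG _ (nowhere_diff_ae hB)
  · refine up_ge_of_const _ 0 ?_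
    simp only [Set.mem_compl_iff, Set.mem_ofPred_eq, not_forall, not_not]
    refine ⟨0, 0, ?_⟩
    simp [HasDerivAtTime, constPath]

end GTP
end

section
/- One-sided weak law of large numbers: let δ_1 > 0, δ_2 > 0, and N ≥ c²/(δ_1 δ_2²). Then the discrete upper probability of the event {(x_1,…,x_N) ∈ [−c,c]^N : (1/N) Σ_{n=1}^N x_n ≥ δ_2} is at most δ_1. -/
open Finset

namespace GTPDiscrete

/-- A strategy for Sceptic: at step `n+1` (i.e. after Reality's moves
`x_1, …, x_n`), Sceptic's move is `S n (x_1, …, x_n)`; it may depend only on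
Reality's previous moves. (Nonnegativity of the moves is stated separately.) -/
def Strategy : Type := (n : ℕ) → (Fin n → ℝ) → ℝ

/-- Sceptic's capital: `K_0 = 1` and `K_{n+1} = K_n + s_{n+1} x_{n+1}`, where
Reality's moves are `x (0), x (1), …` (so `x (n)` is the paper's `x_{n+1}`). -/
noncomputable def capital (S : Strategy) (x : ℕ → ℝ) : ℕ → ℝ
  | 0 => 1
  | n + 1 => capital S x n + S n (fun i => x i) * x n

/-- A strategy with nonnegative moves is prudent (for horizon `N` and bound `c`)
if it guarantees `K_n ≥ 0` for all `n = 0, …, N` and all moves of Reality in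
`[−c,c]`. -/
def Prudent (N : ℕ) (c : ℝ) (S : Strategy) : Prop :=
  (∀ n : ℕ, ∀ p : Fin n → ℝ, 0 ≤ S n p) ∧
    ∀ x : ℕ → ℝ, (∀ i : ℕ, i < N → |x i| ≤ c) → ∀ n : ℕ, n ≤ N → 0 ≤ capital S x n

/-- The discrete upper probability of an event `E ⊆ [−c,c]^N` (an event is a
set of sequences of Reality's moves, `x (n−1)` being the paper's `x_n`):
the infimum of all `δ > 0` such that Sceptic has a prudent strategy that
guarantees `K_N ≥ 1/δ` whenever `(x_1, …, x_N) ∈ E`. -/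
noncomputable def discUpProb (N : ℕ) (c : ℝ) (E : Set (ℕ → ℝ)) : ℝ :=
  sInf {δ : ℝ | 0 < δ ∧ ∃ S : Strategy, Prudent N c S ∧
    ∀ x : ℕ → ℝ, (∀ i : ℕ, i < N → |x i| ≤ c) → x ∈ E → 1 / δ ≤ capital S x N}

/-- Sceptic bets in proportion to the positive part of the current sum. -/
noncomputable def lln_strategy (N : ℕ) (c : ℝ) : Strategy :=
  fun _ p => 2 * max (∑ i, p i) 0 / (N * c ^ 2)

theorem lln_capital_bound (N : ℕ) (hN : 1 ≤ N) (c : ℝ) (hc : 0 < c) (x : ℕ → ℝ)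
    (hx : ∀ i : ℕ, i < N → |x i| ≤ c) (n : ℕ) (hn : n ≤ N) :
    ((max (∑ i ∈ range n, x i) 0) ^ 2 + c ^ 2 * (N - n)) / (N * c ^ 2)
      ≤ capital (lln_strategy N c) x n := by
  have hN' : (0 : ℝ) < N := by exact_mod_cast hN
  have hD : (0 : ℝ) < N * c ^ 2 := by positivity
  induction n with
  | zero =>
    simp only [capital]
    rw [div_le_one hD]
    simp
    linarith
  | succ n ih =>
    have ih := ih (by omega)
    have hxn := hx n (by omega)
    simp only [capital, lln_strategy]
    rw [Fin.sum_univ_eq_sum_range (fun i => x i) n, sum_range_succ]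
    set s := ∑ i ∈ range n, x i
    have hx2 : x n ^ 2 ≤ c ^ 2 := sq_le_sq' (abs_le.mp hxn).1 (abs_le.mp hxn).2
    have key : (max (s + x n) 0) ^ 2 ≤ (max s 0 + x n) ^ 2 := by
      rcases le_total (s + x n) 0 with h | h
      · rw [max_eq_right h]; nlinarith [sq_nonneg (max s 0 + x n)]
      · rw [max_eq_left h]
        have := le_max_left s 0
        exact pow_le_pow_left₀ h (by linarith) 2
    have step : ((max (s + x n) 0) ^ 2 + c ^ 2 * (N - ((n + 1 : ℕ) : ℝ))) / (N * c ^ 2)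
        ≤ ((max s 0) ^ 2 + c ^ 2 * (N - n)) / (N * c ^ 2)
          + 2 * max s 0 / (N * c ^ 2) * x n := by
      rw [div_mul_eq_mul_div, ← add_div]
      apply div_le_div_of_nonneg_right _ hD.le
      push_cast
      nlinarith
    exact step.trans (add_le_add_left ih _)

/-- one-sided weak law of large numbers. If `δ₁ > 0`, `δ₂ > 0`
and `N ≥ c²/(δ₁δ₂²)`, then the discrete upper probability of the event
`(1/N) Σ_{n=1}^N x_n ≥ δ₂` is at most `δ₁`. -/
theorem one_sided_weak_lln (N : ℕ) (hN : 1 ≤ N) (c : ℝ) (hc : 0 < c)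
    (δ₁ δ₂ : ℝ) (h₁ : 0 < δ₁) (h₂ : 0 < δ₂) (hbig : c ^ 2 / (δ₁ * δ₂ ^ 2) ≤ N) :
    discUpProb N c {x : ℕ → ℝ | δ₂ ≤ (1 / N) * ∑ n ∈ range N, x n} ≤ δ₁ := by
  have hN' : (0 : ℝ) < N := by exact_mod_cast hN
  have hD : (0 : ℝ) < N * c ^ 2 := by positivity
  apply csInf_le ⟨0, fun δ h => h.1.le⟩
  refine ⟨h₁, lln_strategy N c, ⟨fun n p => ?_, fun x hx n hn => ?_⟩, fun x hx hE => ?_⟩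
  · unfold lln_strategy
    positivity
  · refine le_trans ?_ (lln_capital_bound N hN c hc x hx n hn)
    have : (0 : ℝ) ≤ N - n := sub_nonneg.mpr (by exact_mod_cast hn)
    positivity
  · refine le_trans ?_ (lln_capital_bound N hN c hc x hx N le_rfl)
    have hE : δ₂ ≤ (1 / N) * ∑ n ∈ range N, x n := hE
    rw [one_div_mul_eq_div, le_div_iff₀ hN'] at hE
    have hm : δ₂ * N ≤ max (∑ n ∈ range N, x n) 0 := hE.trans (le_max_left _ _)
    have hsq := pow_le_pow_left₀ (by positivity) hm 2
    rw [div_le_iff₀ (by positivity)] at hbig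
    rw [div_le_div_iff₀ h₁ hD]
    have h3 := mul_le_mul_of_nonneg_right hsq h₁.le
    have h4 := mul_le_mul_of_nonneg_left hbig hN'.le
    nlinarith

end GTPDiscrete
end

section
/- Fix an integer N ≥ 1 and a real c > 0. Sceptic has a (prudent) strategy that guarantees that his capital satisfies K_n ≥ (N−n)/N + (1/(c²N))·((Σ_{j=1}^n x_j)⁺)² for every n = 0,1,…,N and all Reality's moves x_1,…,x_N ∈ [−c,c], where r⁺ := max(r,0). -/
open Finset

namespace GTPDiscrete

/-- for any horizon `N ≥ 1` and any `c > 0`, Sceptic has a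
(prudent) strategy with nonnegative moves guaranteeing
`K_n ≥ (N−n)/N + (1/(c²N))·((Σ_{j=1}^n x_j)⁺)²` for all `n = 0, …, N` and all
Reality's moves `x_1, …, x_N ∈ [−c,c]`. -/
theorem sceptic_capital_lower_bound (N : ℕ) (hN : 1 ≤ N) (c : ℝ) (hc : 0 < c) :
    ∃ S : Strategy, (∀ n : ℕ, ∀ p : Fin n → ℝ, 0 ≤ S n p) ∧
      ∀ x : ℕ → ℝ, (∀ i : ℕ, i < N → |x i| ≤ c) →
        ∀ n : ℕ, n ≤ N →
          ((N : ℝ) - n) / N + 1 / (c ^ 2 * N) * (max (∑ j ∈ range n, x j) 0) ^ 2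
            ≤ capital S x n := by
  have hNp : (0 : ℝ) < N := by exact_mod_cast hN
  have hk : 0 < 1 / (c ^ 2 * N) := by positivity
  obtain ⟨S, hS⟩ : ∃ S : Strategy, ∀ (n : ℕ) (p : Fin n → ℝ),
      S n p = 1 / (c ^ 2 * N) * (2 * max (∑ j, p j) 0) := ⟨fun n p => _, fun n p => rfl⟩
  refine ⟨S, ?_, ?_⟩
  · intro n p
    rw [hS]
    have := le_max_right (∑ j, p j) 0
    positivity
  · intro x hx n
    induction n with
    | zero =>
      intro _
      simp [capital, hNp.ne']
    | succ n ih =>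
      intro hn
      have h1 := ih (by omega)
      have h2 := abs_le.mp (hx n (by omega))
      have hcap : ∀ S : Strategy, capital S x (n + 1)
          = capital S x n + S n (fun i => x i) * x n := fun _ => rfl
      rw [hcap, hS, Finset.sum_range_succ]
      simp only [Fin.sum_univ_eq_sum_range (fun i => x i) n]
      generalize (∑ j ∈ range n, x j) = t at *
      have key : (max (t + x n) 0) ^ 2 ≤ (max t 0) ^ 2 + 2 * max t 0 * x n + c ^ 2 := by
        rcases le_total t 0 with h | h
        · rw [max_eq_right h]
          rcases le_total (t + x n) 0 with h' | h'
          · rw [max_eq_right h']; nlinarith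
          · rw [max_eq_left h']; nlinarith
        · rw [max_eq_left h]
          rcases le_total (t + x n) 0 with h' | h'
          · rw [max_eq_right h']; nlinarith [sq_nonneg (t + x n)]
          · rw [max_eq_left h']; nlinarith
      have h3 := mul_le_mul_of_nonneg_left key hk.le
      have h4 : 1 / (c ^ 2 * N) * c ^ 2 = 1 / (N : ℝ) := by field_simp
      have h5 : ((N : ℝ) - ((n + 1 : ℕ) : ℝ)) / N = ((N : ℝ) - n) / N - 1 / N := by
        push_cast; ring
      rw [h5]
      linarith

end GTPDiscrete
end
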